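/- arXiv:1510.02132 — 2 statements merged into one kernel-verified Lean document; each statement's English description precedes it below -/
import Mathlib

section
/- For a necklace with monolithic preferences (each bead has positive value to exactly one player), there exists an envy-free allocation of the necklace into n contiguous intervals using only n−1 cuts at integer positions. -/
/-- Discrete value to a player (with bead-valuations `v : Fin k → ℝ`) of the `j`-th
interval of beads in the division given by the integer cutset `c`. -/
noncomputable def pieceVal {k : ℕ} (v : Fin k → ℝ) (c : ℕ → ℕ) (j : ℕ) : ℝ :=
  ∑ b : Fin k, if c j ≤ (b : ℕ) ∧ (b : ℕ) < c (j + 1) then v b else 0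

/-- The sequence `y 0, …, y (n - 1)` followed by `y 0 + n * k`. -/
def extendSeq {n : ℕ} [NeZero n] (k : ℕ) (y : Fin n → ℤ) (i : ℕ) : ℤ :=
  if h : i < n then y ⟨i, h⟩ else y 0 + n * k

/-- The `m`-th vertex of the cell encoded by `y`, a vector of cut positions. -/
def cellVertex {n : ℕ} [NeZero n] (k : ℕ) (y : Fin n → ℤ) (m : Fin n) (i : ℕ) : ℤ :=
  (extendSeq k y i + m) / n - (extendSeq k y 0 + m) / n

/-- The sequences encoding the top-dimensional cells of the Freudenthal triangulation of
`{0 ≤ c 1 ≤ … ≤ c (n - 1) ≤ k}`: the fractional parts of a generic point of the cell are ordered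
like the residues of `y` modulo `n`. -/
structure IsCell {n : ℕ} [NeZero n] (k : ℕ) (y : Fin n → ℤ) : Prop where
  lt_succ : ∀ i < n, extendSeq k y i < extendSeq k y (i + 1)
  residue_inj : ∀ i j, (n : ℤ) ∣ y i - y j → i = j
  sum_eq : ∑ i, y i = ∑ i : Fin n, (i : ℤ)

/-- Exchange the residue classes of `-u - 1` and `-u` modulo `n` by unit moves. -/
def swapResidue (n : ℕ) (u x : ℤ) : ℤ :=
  x + (if (n : ℤ) ∣ x + u + 1 then 1 else 0) - (if (n : ℤ) ∣ x + u then 1 else 0)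

section swapResidue

variable {n : ℕ} {u x x' : ℤ}

theorem not_dvd_and_dvd_add_one (hn : 2 ≤ n) (h : (n : ℤ) ∣ x) : ¬ (n : ℤ) ∣ x + 1 := by
  intro h'
  have h1 : (n : ℤ) ∣ 1 := by simpa using dvd_sub h' h
  have := Int.le_of_dvd one_pos h1
  omega

theorem swapResidue_of_dvd_add_one (hn : 2 ≤ n) (h : (n : ℤ) ∣ x + u + 1) :
    swapResidue n u x = x + 1 := by
  have : ¬ (n : ℤ) ∣ x + u := fun h' => not_dvd_and_dvd_add_one hn h' h
  simp [swapResidue, h, this]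

theorem swapResidue_of_dvd (hn : 2 ≤ n) (h : (n : ℤ) ∣ x + u) :
    swapResidue n u x = x - 1 := by
  simp [swapResidue, h, not_dvd_and_dvd_add_one hn h]

theorem swapResidue_of_not_dvd (h : ¬ (n : ℤ) ∣ x + u + 1) (h' : ¬ (n : ℤ) ∣ x + u) :
    swapResidue n u x = x := by
  simp [swapResidue, h, h']

theorem swapResidue_swapResidue (hn : 2 ≤ n) : swapResidue n u (swapResidue n u x) = x := by
  by_cases h : (n : ℤ) ∣ x + u + 1
  · rw [swapResidue_of_dvd_add_one hn h, swapResidue_of_dvd hn (by convert h using 1; ring)]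
    ring
  by_cases h' : (n : ℤ) ∣ x + u
  · rw [swapResidue_of_dvd hn h', swapResidue_of_dvd_add_one hn (by convert h' using 1; ring)]
    ring
  rw [swapResidue_of_not_dvd h h', swapResidue_of_not_dvd h h']

theorem swapResidue_add_mul (t : ℤ) : swapResidue n u (x + n * t) = swapResidue n u x + n * t := by
  have h1 : (n : ℤ) ∣ x + n * t + u + 1 ↔ (n : ℤ) ∣ x + u + 1 := by
    rw [show x + n * t + u + 1 = x + u + 1 + n * t by ring]
    exact dvd_add_left (dvd_mul_right _ _)
  have h2 : (n : ℤ) ∣ x + n * t + u ↔ (n : ℤ) ∣ x + u := by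
    rw [show x + n * t + u = x + u + n * t by ring]
    exact dvd_add_left (dvd_mul_right _ _)
  simp only [swapResidue, h1, h2]
  ring

theorem dvd_swapResidue_sub (h : (n : ℤ) ∣ x - x') :
    (n : ℤ) ∣ swapResidue n u x - swapResidue n u x' := by
  obtain ⟨t, ht⟩ := h
  obtain rfl : x = x' + n * t := by linarith
  rw [swapResidue_add_mul]
  exact ⟨t, by ring⟩

theorem dvd_of_dvd_swapResidue_sub (hn : 2 ≤ n)
    (h : (n : ℤ) ∣ swapResidue n u x - swapResidue n u x') : (n : ℤ) ∣ x - x' := by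
  simpa only [swapResidue_swapResidue hn] using dvd_swapResidue_sub (u := u) h

theorem add_one_ediv_of_not_dvd (hn : 0 < n) (h : ¬ (n : ℤ) ∣ x + 1) :
    (x + 1) / (n : ℤ) = x / n := by
  have h0 : (0 : ℤ) < n := by exact_mod_cast hn
  have h1 := Int.emod_nonneg x h0.ne'
  have h2 := Int.emod_lt_of_pos x h0
  have h3 := Int.mul_ediv_add_emod x n
  have h4 : x % n + 1 ≠ n := fun h4 => h ⟨x / n + 1, by rw [mul_add]; linarith⟩
  rw [show x + 1 = x % n + 1 + n * (x / n) by linarith, Int.add_mul_ediv_left _ _ h0.ne',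
    Int.ediv_eq_zero_of_lt (by omega) (by omega), zero_add]

theorem not_dvd_of_ne {m u : Fin n} (hmu : m ≠ u) (h : (n : ℤ) ∣ x + u) :
    ¬ (n : ℤ) ∣ x + m := by
  intro h'
  have h1 : (n : ℤ) ∣ (m : ℤ) - u := by simpa using dvd_sub h' h
  have h2 := Int.eq_zero_of_abs_lt_dvd h1 (by rw [abs_lt]; omega)
  exact hmu (Fin.ext (by omega))

theorem swapResidue_ediv (hn : 2 ≤ n) {m u : Fin n} (hmu : m ≠ u) :
    (swapResidue n u x + m) / (n : ℤ) = (x + m) / n := by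
  by_cases h : (n : ℤ) ∣ x + u + 1
  · rw [swapResidue_of_dvd_add_one hn h, add_right_comm, add_one_ediv_of_not_dvd (by omega)]
    rw [add_right_comm] at h ⊢
    exact not_dvd_of_ne hmu h
  by_cases h' : (n : ℤ) ∣ x + u
  · rw [swapResidue_of_dvd hn h', ← add_one_ediv_of_not_dvd (x := x - 1 + m) (by omega)]
    · congr 1
      ring
    · convert not_dvd_of_ne hmu h' using 2
      ring
  rw [swapResidue_of_not_dvd h h']

theorem swapResidue_lt (hn : 2 ≤ n) (hx : x < x') (h : ¬ ((n : ℤ) ∣ x + u + 1 ∧ x' = x + 1)) :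
    swapResidue n u x < swapResidue n u x' := by
  by_cases h1 : (n : ℤ) ∣ x + u + 1
  · have hne : x' ≠ x + 1 := fun h2 => h ⟨h1, h2⟩
    rw [swapResidue_of_dvd_add_one hn h1]
    by_cases h2 : (n : ℤ) ∣ x' + u
    · rw [swapResidue_of_dvd hn h2]
      have h3 : (n : ℤ) ∣ x' - (x + 1) := by
        rw [show x' - (x + 1) = x' + u - (x + u + 1) by ring]
        exact dvd_sub h2 h1
      have := Int.le_of_dvd (by omega) h3
      omega
    · have : x' ≤ swapResidue n u x' := by
        unfold swapResidue
        rw [if_neg h2]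
        split_ifs <;> omega
      omega
  · have h4 : swapResidue n u x ≤ x := by
      unfold swapResidue
      rw [if_neg h1]
      split_ifs <;> omega
    by_cases h2 : (n : ℤ) ∣ x' + u
    · rw [swapResidue_of_dvd hn h2]
      have : x' ≠ x + 1 := by
        rintro rfl
        exact h1 (by convert h2 using 1; ring)
      omega
    · have : x' ≤ swapResidue n u x' := by
        unfold swapResidue
        rw [if_neg h2]
        split_ifs <;> omega
      omega

end swapResidue

section Cell

variable {n : ℕ} [NeZero n] {k : ℕ} {y : Fin n → ℤ}

theorem extendSeq_of_lt {i : ℕ} (h : i < n) : extendSeq k y i = y ⟨i, h⟩ := dif_pos h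

theorem extendSeq_zero : extendSeq k y 0 = y 0 := extendSeq_of_lt (NeZero.pos n)

theorem extendSeq_self : extendSeq k y n = y 0 + n * k := dif_neg (lt_irrefl n)

theorem extendSeq_swapResidue (u : ℤ) (i : ℕ) :
    extendSeq k (fun j => swapResidue n u (y j)) i = swapResidue n u (extendSeq k y i) := by
  unfold extendSeq
  split_ifs
  · rfl
  · rw [swapResidue_add_mul]

theorem cellVertex_swapResidue (hn : 2 ≤ n) {m u : Fin n} (hmu : m ≠ u) :
    cellVertex k (fun j => swapResidue n u (y j)) m = cellVertex k y m := by
  ext i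
  simp only [cellVertex, extendSeq_swapResidue, swapResidue_ediv hn hmu]

theorem cellVertex_zero (m : Fin n) : cellVertex k y m 0 = 0 := sub_self _

theorem cellVertex_self (m : Fin n) : cellVertex k y m n = k := by
  have h0 : (n : ℤ) ≠ 0 := by exact_mod_cast NeZero.ne n
  rw [cellVertex, extendSeq_self, extendSeq_zero, add_right_comm,
    Int.add_mul_ediv_left _ _ h0]
  ring

theorem cellVertex_le_of_le (m : Fin n) {i j : ℕ} (h : extendSeq k y i ≤ extendSeq k y j) :
    cellVertex k y m i ≤ cellVertex k y m j := by
  have h0 : (0 : ℤ) < n := by exact_mod_cast NeZero.pos n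
  exact sub_le_sub_right (Int.ediv_le_ediv h0 (by linarith)) _

theorem cellVertex_mem_Icc (m : Fin n) (i : ℕ) :
    (extendSeq k y i - extendSeq k y 0) / n ≤ cellVertex k y m i ∧
      cellVertex k y m i ≤ (extendSeq k y i - extendSeq k y 0) / n + 1 := by
  have h0 : (0 : ℤ) < n := by exact_mod_cast NeZero.pos n
  unfold cellVertex
  rw [show extendSeq k y i + m =
    (extendSeq k y i - extendSeq k y 0) + (extendSeq k y 0 + m) by ring, Int.add_ediv_of_pos h0]
  split_ifs <;> constructor <;> linarith

namespace IsCell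

theorem extendSeq_le (hy : IsCell k y) {i j : ℕ} (hij : i ≤ j) (hj : j ≤ n) :
    extendSeq k y i ≤ extendSeq k y j := by
  induction j, hij using Nat.le_induction with
  | base => exact le_rfl
  | succ j hij ih => exact (ih (by omega)).trans (hy.lt_succ j (by omega)).le

theorem existsUnique_dvd (hy : IsCell k y) (a : ℤ) : ∃! i, (n : ℤ) ∣ y i + a := by
  have hinj : Function.Injective fun i => (y i : ZMod n) := by
    intro i j hij
    refine hy.residue_inj i j ?_
    rw [← ZMod.intCast_zmod_eq_zero_iff_dvd, Int.cast_sub, sub_eq_zero]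
    exact hij
  have hbij : Function.Bijective fun i => (y i : ZMod n) :=
    (Fintype.bijective_iff_injective_and_card _).2 ⟨hinj, by simp⟩
  obtain ⟨i, hi⟩ := hbij.2 (-(a : ZMod n))
  have hi' : (n : ℤ) ∣ y i + a := by
    rw [← ZMod.intCast_zmod_eq_zero_iff_dvd, Int.cast_add]
    simp only at hi
    rw [hi]
    ring
  refine ⟨i, hi', fun j hj => hy.residue_inj j i ?_⟩
  simpa using dvd_sub hj hi'

theorem sum_ite_dvd (hy : IsCell k y) (a : ℤ) :
    ∑ i, (if (n : ℤ) ∣ y i + a then (1 : ℤ) else 0) = 1 := by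
  obtain ⟨i, hi, hu⟩ := hy.existsUnique_dvd a
  rw [Finset.sum_eq_single i, if_pos hi]
  · intro j _ hj
    exact if_neg fun h => hj (hu j h)
  · simp

theorem sum_swapResidue (hy : IsCell k y) (u : ℤ) :
    ∑ i, swapResidue n u (y i) = ∑ i, y i := by
  simp only [swapResidue, Finset.sum_sub_distrib, Finset.sum_add_distrib, add_assoc,
    hy.sum_ite_dvd]
  ring

theorem swapResidue (hn : 2 ≤ n) (hy : IsCell k y) {u : Fin n}
    (h : ∀ i < n, ∃ m, m ≠ u ∧ cellVertex k y m i < cellVertex k y m (i + 1)) :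
    IsCell k (fun j => swapResidue n u (y j)) where
  lt_succ i hi := by
    rw [extendSeq_swapResidue, extendSeq_swapResidue]
    refine swapResidue_lt hn (hy.lt_succ i hi) ?_
    rintro ⟨h1, h2⟩
    obtain ⟨m, hmu, hm⟩ := h i hi
    refine hm.ne ?_
    unfold cellVertex
    rw [h2, add_right_comm, add_one_ediv_of_not_dvd (by omega)]
    rw [add_right_comm] at h1 ⊢
    exact not_dvd_of_ne hmu h1
  residue_inj i j hij := hy.residue_inj i j (dvd_of_dvd_swapResidue_sub hn hij)
  sum_eq := (hy.sum_swapResidue u).trans hy.sum_eq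

theorem swapResidue_ne (hn : 2 ≤ n) (hy : IsCell k y) (u : ℤ) :
    (fun j => _root_.swapResidue n u (y j)) ≠ y := by
  obtain ⟨i, hi, -⟩ := hy.existsUnique_dvd u
  intro h
  have := congrFun h i
  simp only [swapResidue_of_dvd hn hi] at this
  omega

theorem le_apply (hy : IsCell k y) (i : Fin n) : y 0 ≤ y i := by
  simpa [extendSeq_zero, extendSeq_of_lt i.2] using hy.extendSeq_le (Nat.zero_le i) i.2.le

theorem apply_lt (hy : IsCell k y) (i : Fin n) : y i < y 0 + n * k := by
  have h1 := hy.lt_succ i i.2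
  have h2 := hy.extendSeq_le (show (i : ℕ) + 1 ≤ n from i.2) le_rfl
  rw [extendSeq_of_lt i.2] at h1
  rw [extendSeq_self] at h2
  exact h1.trans_le h2

theorem abs_sub_le (hy : IsCell k y) (i j : Fin n) : |y i - y j| ≤ n * k := by
  have := hy.le_apply i
  have := hy.le_apply j
  have := hy.apply_lt i
  have := hy.apply_lt j
  rw [abs_le]
  constructor <;> linarith

end IsCell

theorem finite_setOf_isCell (n : ℕ) [NeZero n] (k : ℕ) :
    {y : Fin n → ℤ | IsCell k y}.Finite := by
  set B : ℤ := |∑ i : Fin n, (i : ℤ)| + n * (n * k) with hB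
  refine (Set.finite_Icc (fun _ : Fin n => -B) (fun _ => B)).subset fun y hy => ?_
  have key : ∀ i, |y i| ≤ B := by
    intro i
    have h1 : (n : ℤ) * y i = ∑ j : Fin n, (j : ℤ) + ∑ j, (y i - y j) := by
      rw [Finset.sum_sub_distrib, hy.sum_eq]
      simp
    have h2 : |∑ j, (y i - y j)| ≤ n * (n * k) := by
      refine (Finset.abs_sum_le_sum_abs _ _).trans ?_
      refine (Finset.sum_le_sum fun j _ => hy.abs_sub_le i j).trans ?_
      simp
    have h3 : |(n : ℤ) * y i| ≤ B := by
      rw [h1]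
      exact (abs_add_le _ _).trans (by linarith)
    rw [abs_mul, Nat.abs_cast] at h3
    have h4 : (1 : ℤ) ≤ n := by exact_mod_cast NeZero.pos n
    nlinarith [abs_nonneg (y i)]
  exact ⟨fun i => (abs_le.1 (key i)).1, fun i => (abs_le.1 (key i)).2⟩

end Cell

theorem Matrix.det_eq_sum_det_updateRow_single {ι R : Type*} [Fintype ι] [DecidableEq ι]
    [CommRing R] (M : Matrix ι ι R) (a : ι) :
    M.det = ∑ u, (M.updateRow u (Pi.single a 1)).det * ∑ i, M u i := by
  have h := congrFun (congrArg (fun N : Matrix ι ι R => N.mulVec 1) M.adjugate_mul) a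
  simp only [← Matrix.mulVec_mulVec] at h
  simpa [Matrix.mulVec, dotProduct, Matrix.adjugate_apply, Matrix.one_apply, Matrix.smul_apply]
    using h.symm

theorem exists_lt_succ_of_lt {n : ℕ} {c : ℕ → ℤ} (h : c 0 < c n) : ∃ j < n, c j < c (j + 1) := by
  by_contra! hcon
  have : ∀ j ≤ n, c j ≤ c 0 := by
    intro j
    induction j with
    | zero => simp
    | succ j ih => exact fun hj => (hcon j (by omega)).trans (ih (by omega))
  exact (this n le_rfl).not_gt h

section Label

variable {n : ℕ} [NeZero n] {k : ℕ}

/-- The matrix whose `m`-th row is the indicator of the label that `f m` gives the `m`-th vertex. -/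
def labelMatrix (k : ℕ) (f : Fin n → (ℕ → ℤ) → Fin n) (y : Fin n → ℤ) :
    Matrix (Fin n) (Fin n) (ZMod 2) :=
  Matrix.of fun m => Pi.single (f m (cellVertex k y m)) 1

/-- A labelling is proper if it labels every vertex by a nonempty piece. -/
def IsProperLabel (n : ℕ) [NeZero n] (k : ℕ) (f : (ℕ → ℤ) → Fin n) : Prop :=
  ∀ y : Fin n → ℤ, IsCell k y → ∀ m,
    cellVertex k y m (f (cellVertex k y m)) < cellVertex k y m (f (cellVertex k y m) + 1)

/-- The number modulo 2 of cells with pairwise distinct labels. -/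
noncomputable def labelDegree (k : ℕ) (f : Fin n → (ℕ → ℤ) → Fin n) : ZMod 2 :=
  ∑ y ∈ (finite_setOf_isCell n k).toFinset, (labelMatrix k f y).det

/-- The `labelMatrix` of `f` with row `m₀` replaced by its sum with that of `g`, and row `u`
replaced by the indicator of the label of vertex `m₀`. -/
def facetMatrix (k : ℕ) (f g : Fin n → (ℕ → ℤ) → Fin n) (m₀ u : Fin n) (y : Fin n → ℤ) :
    Matrix (Fin n) (Fin n) (ZMod 2) :=
  ((labelMatrix k f y).updateRow m₀ (labelMatrix k f y m₀ + labelMatrix k g y m₀)).updateRow u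
    (Pi.single (f m₀ (cellVertex k y m₀)) 1)

theorem facetMatrix_swapResidue (hn : 2 ≤ n) (f g : Fin n → (ℕ → ℤ) → Fin n) {m₀ u : Fin n}
    (hu : m₀ ≠ u) (y : Fin n → ℤ) :
    facetMatrix k f g m₀ u (fun j => swapResidue n u (y j)) = facetMatrix k f g m₀ u y := by
  ext m i
  by_cases hm : m = u
  · subst hm
    simp [facetMatrix, cellVertex_swapResidue hn hu]
  by_cases hm' : m = m₀
  · subst hm'
    simp [facetMatrix, Matrix.updateRow_ne hm, labelMatrix, cellVertex_swapResidue hn hm]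
  · simp [facetMatrix, Matrix.updateRow_ne hm, Matrix.updateRow_ne hm', labelMatrix,
      cellVertex_swapResidue hn hm]

theorem det_facetMatrix_eq_zero {f g : Fin n → (ℕ → ℤ) → Fin n} (hf : ∀ m, IsProperLabel n k (f m))
    (hg : ∀ m, IsProperLabel n k (g m)) {m₀ u : Fin n} (hu : m₀ ≠ u) {y : Fin n → ℤ}
    (hy : IsCell k y) {i : Fin n}
    (hi : ∀ m, m ≠ u → ¬ cellVertex k y m i < cellVertex k y m (i + 1)) :
    (facetMatrix k f g m₀ u y).det = 0 := by
  have hf' : ∀ m, m ≠ u → i ≠ f m (cellVertex k y m) := fun m hm h =>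
    hi m hm (by rw [h]; exact hf m y hy m)
  have hg' : ∀ m, m ≠ u → i ≠ g m (cellVertex k y m) := fun m hm h =>
    hi m hm (by rw [h]; exact hg m y hy m)
  refine Matrix.det_eq_zero_of_column_eq_zero i fun m => ?_
  by_cases hm : m = u
  · subst hm
    simp [facetMatrix, hf' m₀ hu]
  by_cases hm' : m = m₀
  · subst hm'
    simp [facetMatrix, Matrix.updateRow_ne hm, labelMatrix, hf' m hm, hg' m hm]
  · simp [facetMatrix, Matrix.updateRow_ne hm, Matrix.updateRow_ne hm', labelMatrix, hf' m hm]

theorem sum_det_facetMatrix {f g : Fin n → (ℕ → ℤ) → Fin n} (hf : ∀ m, IsProperLabel n k (f m))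
    (hg : ∀ m, IsProperLabel n k (g m)) {m₀ u : Fin n} (hu : m₀ ≠ u) :
    ∑ y ∈ (finite_setOf_isCell n k).toFinset, (facetMatrix k f g m₀ u y).det = 0 := by
  classical
  have hn : 2 ≤ n := by
    have := m₀.2
    have := u.2
    have : (m₀ : ℕ) ≠ u := fun h => hu (Fin.ext h)
    omega
  have key : ∀ y : Fin n → ℤ, IsCell k y → ¬ IsCell k (fun j => swapResidue n u (y j)) →
      (facetMatrix k f g m₀ u y).det = 0 := by
    intro y hy h
    by_contra hne
    refine h (hy.swapResidue hn fun i hi => ?_)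
    by_contra! hcon
    exact hne (det_facetMatrix_eq_zero hf hg hu hy (i := ⟨i, hi⟩)
      fun m hm => not_lt.2 (hcon m hm))
  refine Finset.sum_involution
    (fun y _ => if IsCell k (fun j => swapResidue n u (y j)) then
      (fun j => swapResidue n u (y j)) else y) ?_ ?_ ?_ ?_
  · intro y hy
    split_ifs
    · rw [facetMatrix_swapResidue hn f g hu, CharTwo.add_self_eq_zero]
    · rw [CharTwo.add_self_eq_zero]
  · intro y hy hne
    have hy' : IsCell k y := by simpa using hy
    rw [if_pos (by by_contra h; exact hne (key y hy' h))]
    exact hy'.swapResidue_ne hn u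
  · intro y hy
    split_ifs with h
    · simpa using h
    · exact hy
  · intro y hy
    have hy' : IsCell k y := by simpa using hy
    by_cases h : IsCell k (fun j => swapResidue n u (y j))
    · simp [h, swapResidue_swapResidue hn, hy']
    · simp [h]

theorem labelDegree_congr {f g : Fin n → (ℕ → ℤ) → Fin n} (hf : ∀ m, IsProperLabel n k (f m))
    (hg : ∀ m, IsProperLabel n k (g m)) (m₀ : Fin n) (h : ∀ m, m ≠ m₀ → f m = g m) :
    labelDegree k f = labelDegree k g := by
  have key : ∀ y, (labelMatrix k f y).det + (labelMatrix k g y).det =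
      ∑ u ∈ Finset.univ.erase m₀, (facetMatrix k f g m₀ u y).det := by
    intro y
    have h1 : (labelMatrix k f y).updateRow m₀ (labelMatrix k g y m₀) = labelMatrix k g y := by
      ext m i
      by_cases hm : m = m₀
      · subst hm
        simp
      · simp [Matrix.updateRow_ne hm, labelMatrix, h m hm]
    calc (labelMatrix k f y).det + (labelMatrix k g y).det
        = ((labelMatrix k f y).updateRow m₀
            (labelMatrix k f y m₀ + labelMatrix k g y m₀)).det := by
          rw [Matrix.det_updateRow_add, h1, Matrix.updateRow_eq_self]
      _ = _ := by
          rw [Matrix.det_eq_sum_det_updateRow_single _ (f m₀ (cellVertex k y m₀)),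
            ← Finset.add_sum_erase _ _ (Finset.mem_univ m₀)]
          have h2 : ∑ i, (labelMatrix k f y).updateRow m₀
              (labelMatrix k f y m₀ + labelMatrix k g y m₀) m₀ i = 0 := by
            simp [labelMatrix, Finset.sum_add_distrib, CharTwo.add_self_eq_zero]
          rw [h2, mul_zero, zero_add]
          refine Finset.sum_congr rfl fun u hu => ?_
          have h3 : ∑ i, (labelMatrix k f y).updateRow m₀
              (labelMatrix k f y m₀ + labelMatrix k g y m₀) u i = 1 := by
            simp [Matrix.updateRow_ne (Finset.ne_of_mem_erase hu), labelMatrix]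
          rw [h3, mul_one, facetMatrix]
  rw [← CharTwo.add_eq_zero, labelDegree, labelDegree, ← Finset.sum_add_distrib]
  simp only [key]
  rw [Finset.sum_comm]
  exact Finset.sum_eq_zero fun u hu =>
    sum_det_facetMatrix hf hg (Finset.ne_of_mem_erase hu).symm

theorem labelDegree_eq {f g : Fin n → (ℕ → ℤ) → Fin n} (hf : ∀ m, IsProperLabel n k (f m))
    (hg : ∀ m, IsProperLabel n k (g m)) : labelDegree k f = labelDegree k g := by
  classical
  have key : ∀ T : Finset (Fin n), labelDegree k (T.piecewise f g) = labelDegree k g := by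
    intro T
    have hT : ∀ (T : Finset (Fin n)) m, IsProperLabel n k (T.piecewise f g m) := by
      intro T m
      by_cases hm : m ∈ T
      · simpa [hm] using hf m
      · simpa [hm] using hg m
    induction T using Finset.induction_on with
    | empty => simp
    | insert a T ha ih =>
      rw [← ih]
      refine labelDegree_congr (hT _) (hT _) a fun m hm => ?_
      simp [Finset.piecewise, hm]
  simpa using key Finset.univ

open Classical in
/-- The first nonempty piece of a division. -/
noncomputable def firstPiece (n : ℕ) [NeZero n] (c : ℕ → ℤ) : Fin n :=
  if h : ∃ j < n, c j < c (j + 1) then ⟨Nat.find h, (Nat.find_spec h).1⟩ else 0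

theorem firstPiece_spec {c : ℕ → ℤ} (h : ∃ j < n, c j < c (j + 1)) :
    c (firstPiece n c) < c (firstPiece n c + 1) := by
  classical
  rw [firstPiece, dif_pos h]
  exact (Nat.find_spec h).2

theorem not_lt_of_lt_firstPiece {c : ℕ → ℤ} {j : ℕ} (hj : j < firstPiece n c) :
    ¬ c j < c (j + 1) := by
  classical
  intro hlt
  have hjn : j < n := hj.trans (firstPiece n c).2
  have h : ∃ j < n, c j < c (j + 1) := ⟨j, hjn, hlt⟩
  rw [firstPiece, dif_pos h] at hj
  exact Nat.find_min h hj ⟨hjn, hlt⟩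

theorem isProperLabel_firstPiece (hk : 0 < k) : IsProperLabel n k (firstPiece n) := by
  intro y _ m
  refine firstPiece_spec (exists_lt_succ_of_lt ?_)
  rw [cellVertex_zero, cellVertex_self]
  exact_mod_cast hk

theorem isCell_val (hk : 0 < k) : IsCell k (fun i : Fin n => (i : ℤ)) where
  lt_succ i hi := by
    have h1 : (n : ℤ) ≤ n * k := by
      have : (1 : ℤ) ≤ k := by exact_mod_cast hk
      nlinarith
    unfold extendSeq
    rw [dif_pos hi]
    split_ifs
    · simp
    · simp only [Fin.val_zero, Nat.cast_zero]
      omega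
  residue_inj i j h := by
    have := Int.eq_zero_of_abs_lt_dvd h (by rw [abs_lt]; omega)
    exact Fin.ext (by omega)
  sum_eq := rfl

theorem IsCell.eq_val {y : Fin n → ℤ} (hy : IsCell k y) {m : Fin n}
    (h : (firstPiece n (cellVertex k y m) : ℕ) + 1 = n) : y = fun i : Fin n => (i : ℤ) := by
  have h0 : (0 : ℤ) < n := by exact_mod_cast NeZero.pos n
  have hdiv : ∀ i < n, (extendSeq k y i + m) / n = (extendSeq k y 0 + m) / n := by
    intro i
    induction i with
    | zero => simp
    | succ i ih =>
      intro hi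
      have h1 := not_lt.1 (not_lt_of_lt_firstPiece (n := n) (c := cellVertex k y m) (j := i)
        (by omega))
      have h2 := cellVertex_le_of_le m (hy.lt_succ i (by omega)).le
      have h3 := ih (by omega)
      unfold cellVertex at h1 h2
      linarith
  set q := (extendSeq k y 0 + m) / n with hq
  have hlow : ∀ i < n, n * q + i ≤ extendSeq k y i + m := by
    intro i
    induction i with
    | zero =>
      intro _
      have := Int.mul_ediv_self_le (x := extendSeq k y 0 + m) h0.ne'
      simpa using this
    | succ i ih =>
      intro hi
      have h1 := ih (by omega)
      have h2 := hy.lt_succ i (by omega)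
      push_cast
      linarith
  have hup : ∀ j i, i + j + 1 = n → extendSeq k y i + m ≤ n * q + i := by
    intro j
    induction j with
    | zero =>
      intro i hi
      have h1 := Int.lt_mul_ediv_self_add (x := extendSeq k y i + m) h0
      rw [hdiv i (by omega)] at h1
      have : (n : ℤ) = i + 1 := by exact_mod_cast hi.symm
      linarith
    | succ j ih =>
      intro i hi
      have h1 := ih (i + 1) (by omega)
      have h2 := hy.lt_succ i (by omega)
      push_cast at h1
      linarith
  have hval : ∀ i : Fin n, y i = i + (n * q - m) := by
    intro i
    have h1 := hlow i i.2
    have h2 := hup (n - 1 - i) i (by omega)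
    rw [extendSeq_of_lt i.2] at h1 h2
    simp only [Fin.eta] at h1 h2
    linarith
  have hsum := hy.sum_eq
  simp only [hval, Finset.sum_add_distrib, Finset.sum_const, Finset.card_univ, Fintype.card_fin,
    nsmul_eq_mul, add_eq_left, mul_eq_zero, h0.ne', false_or] at hsum
  ext i
  rw [hval, hsum, add_zero]

theorem firstPiece_cellVertex_val (hk : 0 < k) (m : Fin n) :
    firstPiece n (cellVertex k (fun i : Fin n => (i : ℤ)) m) = m.rev := by
  have h0 : (0 : ℤ) < n := by exact_mod_cast NeZero.pos n
  set c := cellVertex k (fun i : Fin n => (i : ℤ)) m with hc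
  have hsmall : ∀ i : ℕ, i + m < n → c i = 0 := by
    intro i hi
    have h1 : ((i : ℤ) + m) / n = 0 := Int.ediv_eq_zero_of_lt (by positivity) (by exact_mod_cast hi)
    have h2 : ((0 : ℤ) + m) / n = 0 := Int.ediv_eq_zero_of_lt (by positivity) (by have := m.2; omega)
    rw [hc, cellVertex, extendSeq_of_lt (by omega), extendSeq_zero]
    simp only [Fin.val_zero, Nat.cast_zero]
    rw [h1, h2, sub_zero]
  have hrev : (m.rev : ℕ) + 1 + m = n := by
    rw [Fin.val_rev]
    omega
  have hbig : 0 < c (m.rev + 1) := by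
    by_cases hm : (m : ℕ) = 0
    · have : (m.rev : ℕ) + 1 = n := by omega
      rw [this, hc, cellVertex_self]
      exact_mod_cast hk
    · have h1 : (((m.rev + 1 : ℕ) : ℤ) + m) = n := by exact_mod_cast hrev
      have h2 : ((0 : ℤ) + m) / n = 0 :=
        Int.ediv_eq_zero_of_lt (by positivity) (by have := m.2; omega)
      rw [hc, cellVertex, extendSeq_of_lt (by omega), extendSeq_zero]
      simp only [Fin.val_zero, Nat.cast_zero]
      rw [h1, h2, Int.ediv_self h0.ne']
      norm_num
  have hlt : c m.rev < c (m.rev + 1) := by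
    rw [hsmall _ (by omega)]
    exact hbig
  have hspec := firstPiece_spec (n := n) ⟨m.rev, m.rev.2, hlt⟩
  refine Fin.ext (le_antisymm ?_ ?_)
  · by_contra! hcon
    exact not_lt_of_lt_firstPiece hcon hlt
  · by_contra! hcon
    rw [hsmall _ (by omega), hsmall _ (by omega)] at hspec
    exact lt_irrefl _ hspec

theorem labelDegree_firstPiece_ne_zero (hk : 0 < k) :
    labelDegree k (fun _ : Fin n => firstPiece n) ≠ 0 := by
  rw [labelDegree, Finset.sum_eq_single fun i : Fin n => (i : ℤ)]
  · have h1 : labelMatrix k (fun _ : Fin n => firstPiece n) (fun i : Fin n => (i : ℤ)) =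
        (1 : Matrix (Fin n) (Fin n) (ZMod 2)).submatrix Fin.revPerm id := by
      ext m i
      simp [labelMatrix, firstPiece_cellVertex_val hk, Matrix.one_apply, Pi.single_apply, eq_comm]
    rw [h1, Matrix.det_permute, Matrix.det_one, mul_one]
    rcases Int.units_eq_one_or (Equiv.Perm.sign (Fin.revPerm (n := n))) with h | h <;> simp [h]
  · intro y hy hne
    have hy' : IsCell k y := by simpa using hy
    have hpos := NeZero.pos n
    refine Matrix.det_eq_zero_of_column_eq_zero ⟨n - 1, by omega⟩ fun m => ?_
    refine Pi.single_eq_of_ne (fun h => hne (hy'.eq_val (m := m) ?_)) _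
    have := congrArg Fin.val h
    simp only at this
    omega
  · intro h
    exact absurd (by simpa using isCell_val hk) h

/-- Sperner's lemma for the triangulated space of divisions, with one labelling per player. -/
theorem exists_isCell_label_injective (hk : 0 < k) {f : Fin n → (ℕ → ℤ) → Fin n}
    (hf : ∀ m, IsProperLabel n k (f m)) :
    ∃ y, IsCell k y ∧ Function.Injective fun m => f m (cellVertex k y m) := by
  have h := labelDegree_firstPiece_ne_zero (n := n) hk
  rw [← labelDegree_eq hf fun _ => isProperLabel_firstPiece hk] at h
  obtain ⟨y, hy, hne⟩ := Finset.exists_ne_zero_of_sum_ne_zero h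
  refine ⟨y, by simpa using hy, fun i j hij => ?_⟩
  by_contra hcon
  refine hne (Matrix.det_zero_of_row_eq hcon ?_)
  exact congrArg (fun l => (Pi.single l 1 : Fin n → ZMod 2)) hij

end Label

theorem exists_nonempty_piece_forall_pieceVal_le {k n : ℕ} [NeZero n] {v : Fin k → ℝ}
    (hv : ∀ b, 0 ≤ v b) {c : ℕ → ℕ} (hc : c 0 < c n) :
    ∃ j : Fin n, c j < c (j + 1) ∧ ∀ i : Fin n, pieceVal v c i ≤ pieceVal v c j := by
  obtain ⟨j, hj⟩ := Finite.exists_max fun j : Fin n => pieceVal v c j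
  by_cases h : c j < c (j + 1)
  · exact ⟨j, h, hj⟩
  have hzero : pieceVal v c j = 0 :=
    Finset.sum_eq_zero fun b _ => if_neg (by omega)
  obtain ⟨i, hi, hlt⟩ :=
    exists_lt_succ_of_lt (n := n) (c := fun i => (c i : ℤ)) (by exact_mod_cast hc)
  refine ⟨⟨i, hi⟩, by exact_mod_cast hlt, fun i' => (hj i').trans ?_⟩
  rw [hzero]
  refine Finset.sum_nonneg fun b _ => ?_
  split_ifs
  exacts [hv b, le_rfl]

theorem pieceVal_congr {k : ℕ} {v : Fin k → ℝ} {c d : ℕ → ℕ} {j : ℕ}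
    (h : ∀ b : Fin k, v b ≠ 0 →
      (c j ≤ b ↔ d j ≤ b) ∧ (c (j + 1) ≤ b ↔ d (j + 1) ≤ b)) :
    pieceVal v c j = pieceVal v d j := by
  refine Finset.sum_congr rfl fun b _ => ?_
  by_cases hb : v b = 0
  · simp [hb]
  · simp only [← not_le, h b hb]

/-- a necklace of `k` beads with monolithic preferences — each bead `b`
is worth `w b > 0` to the unique player `ℓ b` and `0` to everyone else — admits an
envy-free allocation into `n` contiguous intervals using only `n - 1` integer cuts. -/
theorem monolithic_envy_free
    (k n : ℕ) (hn : 0 < n) (ℓ : Fin k → Fin n) (w : Fin k → ℝ) (hw : ∀ b, 0 < w b) :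
    ∃ c : ℕ → ℕ, (∀ i < n, c i ≤ c (i + 1)) ∧ c 0 = 0 ∧ c n = k ∧
      ∃ π : Equiv.Perm (Fin n), ∀ P : Fin n, ∀ j : Fin n,
        pieceVal (fun b => if ℓ b = P then w b else 0) c j ≤
          pieceVal (fun b => if ℓ b = P then w b else 0) c (π P) := by
  classical
  have : NeZero n := ⟨hn.ne'⟩
  have hn0 : (0 : ℤ) < n := by exact_mod_cast hn
  rcases Nat.eq_zero_or_pos k with rfl | hk
  · exact ⟨fun _ => 0, by simp, rfl, rfl, Equiv.refl _, by simp [pieceVal]⟩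
  set v : Fin n → Fin k → ℝ := fun P b => if ℓ b = P then w b else 0 with hv
  have hv0 : ∀ P b, 0 ≤ v P b := by
    intro P b
    simp only [hv]
    split_ifs
    exacts [(hw b).le, le_rfl]
  have hchoice : ∀ (P : Fin n) (c : ℕ → ℤ), ∃ j : Fin n,
      (c 0).toNat < (c n).toNat → (c j).toNat < (c (j + 1)).toNat ∧
        ∀ i : Fin n, pieceVal (v P) (fun i => (c i).toNat) i ≤
          pieceVal (v P) (fun i => (c i).toNat) j := by
    intro P c
    by_cases h : (c 0).toNat < (c n).toNat
    · obtain ⟨j, hj⟩ := exists_nonempty_piece_forall_pieceVal_le (hv0 P)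
        (c := fun i => (c i).toNat) h
      exact ⟨j, fun _ => hj⟩
    · exact ⟨0, fun h' => absurd h' h⟩
  choose f hf using hchoice
  have hends : ∀ (y : Fin n → ℤ) m,
      (cellVertex k y m 0).toNat < (cellVertex k y m n).toNat := by
    intro y m
    rw [cellVertex_zero, cellVertex_self]
    simpa using hk
  obtain ⟨y, hy, hinj⟩ := exists_isCell_label_injective hk (f := f) (by
    intro P y _ m
    have := (hf P _ (hends y m)).1
    omega)
  set Q : ℕ → ℤ := fun i => (extendSeq k y i - extendSeq k y 0) / n with hQ
  have hQmono : ∀ i < n, Q i ≤ Q (i + 1) := fun i hi =>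
    Int.ediv_le_ediv hn0 (by linarith [hy.lt_succ i hi])
  have hQ0 : ∀ i ≤ n, 0 ≤ Q i := fun i hi =>
    Int.ediv_nonneg (by linarith [hy.extendSeq_le (Nat.zero_le i) hi]) hn0.le
  have hQk : ∀ i < n, Q i < k := by
    intro i hi
    refine Int.ediv_lt_of_lt_mul hn0 ?_
    have := hy.apply_lt ⟨i, hi⟩
    rw [extendSeq_of_lt hi, extendSeq_zero]
    linarith
  have hQn : Q n = k := by
    simp only [hQ, extendSeq_self, extendSeq_zero]
    rw [add_sub_cancel_left, Int.mul_ediv_cancel_left _ hn0.ne']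
  /- The player deciding the position of the `i`-th cut is the owner of the bead it sweeps. -/
  set owner : ℕ → Fin n := fun i => if h : (Q i).toNat < k then ℓ ⟨(Q i).toNat, h⟩ else 0
    with howner
  set d : ℕ → ℤ := fun i => cellVertex k y (owner i) i with hd
  have hVQ : ∀ m i, Q i ≤ cellVertex k y m i ∧ cellVertex k y m i ≤ Q i + 1 :=
    fun m i => cellVertex_mem_Icc m i
  have hdmono : ∀ i < n, d i ≤ d (i + 1) := by
    intro i hi
    rcases (hQmono i hi).eq_or_lt with h | h
    · have : owner i = owner (i + 1) := by simp only [howner, h]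
      simp only [hd, ← this]
      exact cellVertex_le_of_le _ (hy.lt_succ i hi).le
    · have h1 := (hVQ (owner i) i).2
      have h2 := (hVQ (owner (i + 1)) (i + 1)).1
      simp only [hd]
      omega
  have hcut : ∀ P (b : Fin k), v P b ≠ 0 → ∀ i ≤ n,
      ((d i).toNat ≤ b ↔ (cellVertex k y P i).toNat ≤ b) := by
    intro P b hb i hi
    have hP : ℓ b = P := by
      by_contra h
      exact hb (if_neg h)
    have h0 := hQ0 i hi
    have h1 := hVQ (owner i) i
    have h2 := hVQ P i
    by_cases hQb : (Q i).toNat = b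
    · have : owner i = P := by
        simp only [howner, hQb, b.2, dif_pos, Fin.eta, hP]
      simp only [hd, this]
    · simp only [hd]
      omega
  have hval : ∀ P (j : Fin n), pieceVal (v P) (fun i => (d i).toNat) j =
      pieceVal (v P) (fun i => (cellVertex k y P i).toNat) j := fun P j =>
    pieceVal_congr fun b hb => ⟨hcut P b hb j j.2.le, hcut P b hb (j + 1) j.2⟩
  refine ⟨fun i => (d i).toNat, fun i hi => Int.toNat_le_toNat (hdmono i hi), ?_, ?_,
    Equiv.ofBijective _ (Finite.injective_iff_bijective.1 hinj), fun P j => ?_⟩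
  · simp only [hd, cellVertex_zero, Int.toNat_zero]
  · simp only [hd, cellVertex_self, Int.toNat_natCast]
  · have := (hf P _ (hends y P)).2 j
    rw [← hval, ← hval] at this
    exact this
end

section
/- A 2-dimensional k × l grid of indivisible squares with monolithic preferences admits an envy-free allocation among n players using n−1 non-intersecting cuts; in particular, restricting to a 1 × m grid recovers the one-dimensional monolithic envy-free necklace division theorem. -/
/-- `p 0, p 1, …, p m` is a cut of the `k × l` grid (rows indexed `0,…,k-1` from the
bottom, columns `0,…,l-1`): a simple contiguous path of lattice edges from the top
boundary to the bottom boundary, staying within the grid. -/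
def IsCut (k l m : ℕ) (p : ℕ → ℤ × ℤ) : Prop :=
  (∀ i ≤ m, 0 ≤ (p i).1 ∧ (p i).1 ≤ (l : ℤ) ∧ 0 ≤ (p i).2 ∧ (p i).2 ≤ (k : ℤ)) ∧
  (p 0).2 = (k : ℤ) ∧ (p m).2 = 0 ∧
  (∀ i < m, ((p i).1 = (p (i + 1)).1 ∧ ((p i).2 - (p (i + 1)).2) ^ 2 = 1) ∨
            ((p i).2 = (p (i + 1)).2 ∧ ((p i).1 - (p (i + 1)).1) ^ 2 = 1)) ∧
  (∀ i ≤ m, ∀ j ≤ m, p i = p j → i = j)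

/-- Number of times the leftward horizontal ray from the center of the square in row
`r`, column `c` crosses the cut `p` (of length `m`): the number of vertical steps of
the cut at height spanning `[r, r+1]` and `x`-coordinate at most `c`.  The square is
on the left side of the cut iff this count is even. -/
def crossCount (m : ℕ) (p : ℕ → ℤ × ℤ) (r c : ℕ) : ℕ :=
  ((Finset.range m).filter (fun i =>
    (p i).1 = (p (i + 1)).1 ∧ (p i).1 ≤ (c : ℤ) ∧
      min (p i).2 (p (i + 1)).2 = (r : ℤ))).card

section Sperner

variable {d : ℕ}

/-- Cyclic gap between the `t`-th and `(t+1)`-st cut on a circle of circumference `M`. -/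
def cycGap (M : ℤ) (x : Fin (d + 2) → ℤ) (t : Fin (d + 2)) : ℤ :=
  x (t + 1) - x t + if t = Fin.last (d + 1) then M else 0

/-- The `j`-th vertex of the Kuhn simplex with base `v` in which coordinate `t` is
increased at step `τ t`. -/
def kuhnVertex (v : Fin (d + 2) → ℤ) (τ : Equiv.Perm (Fin (d + 2))) (j t : Fin (d + 2)) : ℤ :=
  v t + if τ t < j then 1 else 0

/-- Base point of the neighbouring simplex obtained by replacing the `i`-th vertex. -/
def pivotBase (v : Fin (d + 2) → ℤ) (τ : Equiv.Perm (Fin (d + 2))) (i t : Fin (d + 2)) : ℤ :=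
  v t + if i = 0 then (if τ t = 0 then 1 else 0) - (if τ t = Fin.last (d + 1) then 1 else 0) else 0

/-- Step order of the neighbouring simplex obtained by replacing the `i`-th vertex. -/
def pivotRank (τ : Equiv.Perm (Fin (d + 2))) (i : Fin (d + 2)) : Equiv.Perm (Fin (d + 2)) :=
  τ.trans (Equiv.swap (i - 1) i)

theorem cycGap_kuhnVertex (M : ℤ) (v : Fin (d + 2) → ℤ) (τ : Equiv.Perm (Fin (d + 2)))
    (j t : Fin (d + 2)) :
    cycGap M (kuhnVertex v τ j) t =
      cycGap M v t + (if τ (t + 1) < j then 1 else 0) - (if τ t < j then 1 else 0) := by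
  simp only [cycGap, kuhnVertex]; ring

theorem val_pivotRank (τ : Equiv.Perm (Fin (d + 2))) (i t : Fin (d + 2)) :
    (pivotRank τ i t : ℕ) =
      if (τ t : ℕ) = (i - 1 : Fin (d + 2)) then (i : ℕ)
      else if (τ t : ℕ) = i then ((i - 1 : Fin (d + 2)) : ℕ) else τ t := by
  simp only [pivotRank, Equiv.trans_apply, Equiv.swap_apply_def, Fin.ext_iff, apply_ite Fin.val]

theorem kuhnVertex_pivot (v : Fin (d + 2) → ℤ) (τ : Equiv.Perm (Fin (d + 2)))
    (i j t : Fin (d + 2)) :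
    kuhnVertex (pivotBase v τ i) (pivotRank τ i) j t =
      kuhnVertex v τ j t +
        if j = i then (if τ t = i then 1 else 0) - (if τ t = i - 1 then 1 else 0) else 0 := by
  have hp := val_pivotRank τ i t
  have hi := Fin.coe_sub_one i
  have hr := (τ t).2
  have hj := j.2
  simp only [kuhnVertex, pivotBase, Fin.ext_iff, Fin.lt_def, Fin.val_last, Fin.val_zero] at *
  split_ifs at hp hi <;> omega

theorem sub_one_ne_self' (i : Fin (d + 2)) : i - 1 ≠ i := by
  intro h; have := sub_eq_self.mp h; simp at this

theorem add_one_ne_self' (i : Fin (d + 2)) : i + 1 ≠ i := by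
  intro h; have := add_eq_left.mp h; simp at this

theorem pivotRank_pivotRank (τ : Equiv.Perm (Fin (d + 2))) (i : Fin (d + 2)) :
    pivotRank (pivotRank τ i) i = τ := by
  ext t; simp [pivotRank]

theorem pivotBase_pivotBase (v : Fin (d + 2) → ℤ) (τ : Equiv.Perm (Fin (d + 2)))
    (i : Fin (d + 2)) : pivotBase (pivotBase v τ i) (pivotRank τ i) i = v := by
  ext t
  have hp := val_pivotRank τ i t
  have hi := Fin.coe_sub_one i
  have hr := (τ t).2
  simp only [pivotBase, Fin.ext_iff, Fin.val_last, Fin.val_zero] at *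
  split_ifs at hp hi <;> omega

theorem sum_pivotBase (v : Fin (d + 2) → ℤ) (τ : Equiv.Perm (Fin (d + 2)))
    (i : Fin (d + 2)) : ∑ t, pivotBase v τ i t = ∑ t, v t := by
  simp only [pivotBase, Finset.sum_add_distrib]
  by_cases hi : i = 0
  · have h : ∀ a : Fin (d + 2), ∑ t, (if τ t = a then (1 : ℤ) else 0) = 1 := fun a => by
      rw [Equiv.sum_comp τ (fun r => if r = a then (1 : ℤ) else 0)]; simp
    simp [hi, Finset.sum_sub_distrib, h]
  · simp [hi]

theorem sum_kuhnVertex (v : Fin (d + 2) → ℤ) (τ : Equiv.Perm (Fin (d + 2)))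
    (j : Fin (d + 2)) : ∑ t, kuhnVertex v τ j t = ∑ t, v t + (j : ℕ) := by
  simp only [kuhnVertex, Finset.sum_add_distrib]
  rw [Equiv.sum_comp τ (fun r => if r < j then (1 : ℤ) else 0), Finset.sum_boole]
  congr 2
  have : Finset.univ.filter (fun x : Fin (d + 2) => x < j) = Finset.Iio j := by ext; simp
  rw [this, Fin.card_Iio]

/-- If every vertex of a simplex has nonnegative gaps but the replacement of its `i`-th vertex
has not, then the facet opposite to the `i`-th vertex lies on the face where the gap after
the `i`-th moved cut vanishes. -/
theorem facet_gap_eq_zero {M : ℤ} {v : Fin (d + 2) → ℤ} {τ : Equiv.Perm (Fin (d + 2))}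
    {i : Fin (d + 2)} (hdom : ∀ j t, 0 ≤ cycGap M (kuhnVertex v τ j) t)
    {t : Fin (d + 2)}
    (hneg : cycGap M (kuhnVertex (pivotBase v τ i) (pivotRank τ i) i) t < 0) :
    τ t = i ∧ τ (t + 1) = i - 1 ∧ ∀ j ≠ i, cycGap M (kuhnVertex v τ j) t = 0 := by
  have e : cycGap M (kuhnVertex (pivotBase v τ i) (pivotRank τ i) i) t =
      cycGap M (kuhnVertex v τ i) t
        + ((if τ (t + 1) = i then 1 else 0) - (if τ (t + 1) = i - 1 then 1 else 0))
        - ((if τ t = i then 1 else 0) - (if τ t = i - 1 then 1 else 0)) := by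
    simp only [cycGap, kuhnVertex_pivot, if_true]; ring
  have hne : τ (t + 1) ≠ τ t := fun h => add_one_ne_self' t (τ.injective h)
  rw [e] at hneg
  have hi := hdom i t
  have hp := hdom (i - 1) t
  have hn := hdom (i + 1) t
  simp only [cycGap_kuhnVertex] at hneg hi hp hn ⊢
  generalize τ t = r at *
  generalize τ (t + 1) = s at *
  generalize cycGap M v t = g at *
  have hp1 := Fin.coe_sub_one i
  have hn1 := Fin.val_add_one i
  have hr := r.2
  have hs := s.2
  have hi2 := i.2
  simp only [Fin.ext_iff, Fin.lt_def, hp1, hn1, Fin.val_last, Fin.val_zero, ne_eq] at *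
  have hd : ¬ 0 = d + 1 := by omega
  by_cases h0 : (i : ℕ) = 0
  · simp only [h0, hd, if_true, if_false] at *
    refine ⟨?_, ?_, fun j hj => ?_⟩ <;> omega
  · by_cases h1 : (i : ℕ) = d + 1
    · simp only [h1, if_true, Nat.add_eq_zero_iff, one_ne_zero, and_false, if_false] at *
      refine ⟨?_, ?_, fun j hj => ?_⟩ <;> omega
    · simp only [h0, h1, if_false] at *
      refine ⟨?_, ?_, fun j hj => ?_⟩ <;> omega

/-- Base point of the corner simplex. -/
def cornerBase (M : ℤ) (t : Fin (d + 2)) : ℤ := if t = Fin.last (d + 1) then M else 0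

/-- Step order of the corner simplex: the cuts `d, d - 1, …, 0` and then `d + 1`. -/
def cornerRank (d : ℕ) : Equiv.Perm (Fin (d + 2)) := Equiv.subLeft (Fin.last (d + 1) - 1)

theorem val_cornerRank (t : Fin (d + 2)) :
    (cornerRank d t : ℕ) = if (t : ℕ) = d + 1 then d + 1 else d - t := by
  have h1 : ((Fin.last (d + 1) - 1 : Fin (d + 2)) : ℕ) = d := by
    rw [Fin.coe_sub_one]; simp [Fin.ext_iff]
  have ht := t.2
  rw [cornerRank, Equiv.subLeft_apply, Fin.sub_def]
  simp only [h1]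
  split_ifs with h
  · rw [h, Nat.mod_eq_of_lt (by omega)]; omega
  · have : d + 2 - (t : ℕ) + d = (d - t) + (d + 2) := by omega
    rw [this, Nat.add_mod_right, Nat.mod_eq_of_lt (by omega)]

theorem val_add_one' (t : Fin (d + 2)) :
    ((t + 1 : Fin (d + 2)) : ℕ) = if (t : ℕ) = d + 1 then 0 else (t : ℕ) + 1 := by
  rw [Fin.val_add_one]; simp [Fin.ext_iff]

theorem cycGap_corner (M : ℤ) (j t : Fin (d + 2)) :
    cycGap M (kuhnVertex (cornerBase M) (cornerRank d) j) t =
      (if (t : ℕ) = d then M else 0) +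
        (if (t : ℕ) + j = d ∧ 0 < (j : ℕ) then 1 else 0) +
        (if (t : ℕ) = d ∧ 0 < (j : ℕ) then -1 else 0) +
        (if (t : ℕ) = d + 1 ∧ (j : ℕ) = d + 1 then 1 else 0) := by
  have h1 := val_cornerRank t
  have h2 := val_cornerRank (t + 1)
  have h3 := val_add_one' t
  have ht := t.2
  have hj := j.2
  simp only [cycGap_kuhnVertex]
  simp only [cycGap, cornerBase, Fin.lt_def, Fin.ext_iff, Fin.val_last] at *
  split_ifs at h1 h2 h3 <;> omega

/-- A door: a simplex with base of coordinate sum `M` and nonnegative gaps, whose vertices other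
than the `i`-th carry all labels but the last one. -/
structure IsDoor (M : ℤ) (L : Fin (d + 2) → (Fin (d + 2) → ℤ) → Fin (d + 2))
    (x : (Fin (d + 2) → ℤ) × Equiv.Perm (Fin (d + 2)) × Fin (d + 2)) : Prop where
  sum_eq : ∑ t, x.1 t = M
  nonneg : ∀ j t, 0 ≤ cycGap M (kuhnVertex x.1 x.2.1 j) t
  inj : Function.Injective
    (Function.update (fun j => L j (kuhnVertex x.1 x.2.1 j)) x.2.2 (Fin.last (d + 1)))

/-- A labelling such that labels are nonempty gaps, and the label is the first nonempty gap
if the last gap is empty. -/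
structure IsLabelling (M : ℤ) (L : Fin (d + 2) → (Fin (d + 2) → ℤ) → Fin (d + 2)) : Prop where
  pos : ∀ j x, (∀ t, 0 ≤ cycGap M x t) → 0 < cycGap M x (L j x)
  first : ∀ j x, (∀ t, 0 ≤ cycGap M x t) → cycGap M x (Fin.last (d + 1)) = 0 →
    ∀ t, 0 < cycGap M x t → L j x ≤ t

theorem IsDoor.exists_label {M : ℤ} {L : Fin (d + 2) → (Fin (d + 2) → ℤ) → Fin (d + 2)}
    {v : Fin (d + 2) → ℤ} {τ : Equiv.Perm (Fin (d + 2))} {i : Fin (d + 2)}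
    (h : IsDoor M L (v, τ, i)) {s : Fin (d + 2)} (hs : s ≠ Fin.last (d + 1)) :
    ∃ j, j ≠ i ∧ L j (kuhnVertex v τ j) = s := by
  obtain ⟨j, hj⟩ := Finite.injective_iff_surjective.mp h.inj s
  by_cases hji : j = i
  · subst hji; simp at hj; exact absurd hj.symm hs
  · exact ⟨j, hji, by simpa [hji] using hj⟩

theorem isDoor_corner {M : ℤ} (hM : 0 < M) {L : Fin (d + 2) → (Fin (d + 2) → ℤ) → Fin (d + 2)}
    (hL : IsLabelling M L) : IsDoor M L (cornerBase M, cornerRank d, Fin.last (d + 1)) := by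
  have hdom : ∀ j t : Fin (d + 2),
      0 ≤ cycGap M (kuhnVertex (cornerBase M) (cornerRank d) j) t := fun j t => by
    rw [cycGap_corner]; omega
  refine ⟨by simp [cornerBase], hdom, ?_⟩
  have hlab : ∀ j : Fin (d + 2), j ≠ Fin.last (d + 1) →
      (L j (kuhnVertex (cornerBase M) (cornerRank d) j) : ℕ) = d - j := fun j hj => by
    have hj1 : (j : ℕ) < d + 1 := Fin.val_lt_last hj
    obtain ⟨s, hs⟩ : ∃ s : Fin (d + 2), (s : ℕ) = d - j := ⟨⟨d - j, by omega⟩, rfl⟩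
    have h1 := hL.pos j _ (hdom j)
    have h2 := hL.first j _ (hdom j)
      (by rw [cycGap_corner]; simp only [Fin.val_last]; omega) s
      (by rw [cycGap_corner]; omega)
    rw [cycGap_corner] at h1
    rw [Fin.le_def] at h2
    generalize (L j (kuhnVertex (cornerBase M) (cornerRank d) j)) = r at *
    omega
  intro a b hab
  simp only [Function.update_apply] at hab
  split_ifs at hab with ha hb hb
  · rw [ha, hb]
  · have := hlab b hb; rw [← hab, Fin.val_last] at this; omega
  · have := hlab a ha; rw [hab, Fin.val_last] at this; omega
  · have h1 := hlab a ha
    have h2 := hlab b hb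
    have := Fin.val_lt_last ha
    have := Fin.val_lt_last hb
    rw [hab] at h1
    apply Fin.ext; omega

/-- Replacement of the `i`-th vertex. -/
def pivot (x : (Fin (d + 2) → ℤ) × Equiv.Perm (Fin (d + 2)) × Fin (d + 2)) :
    (Fin (d + 2) → ℤ) × Equiv.Perm (Fin (d + 2)) × Fin (d + 2) :=
  (pivotBase x.1 x.2.1 x.2.2, pivotRank x.2.1 x.2.2, x.2.2)

theorem pivot_pivot (x : (Fin (d + 2) → ℤ) × Equiv.Perm (Fin (d + 2)) × Fin (d + 2)) :
    pivot (pivot x) = x := by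
  obtain ⟨v, τ, i⟩ := x
  simp [pivot, pivotBase_pivotBase, pivotRank_pivotRank]

theorem pivot_ne (x : (Fin (d + 2) → ℤ) × Equiv.Perm (Fin (d + 2)) × Fin (d + 2)) :
    pivot x ≠ x := by
  obtain ⟨v, τ, i⟩ := x
  intro h
  have h1 : pivotRank τ i = τ := congrArg (fun y => y.2.1) h
  have h2 : (pivotRank τ i) (τ.symm i) = i := by rw [h1]; simp
  simp only [pivotRank, Equiv.trans_apply, Equiv.apply_symm_apply, Equiv.swap_apply_right] at h2
  exact sub_one_ne_self' i h2

theorem kuhnVertex_pivot_of_ne (v : Fin (d + 2) → ℤ) (τ : Equiv.Perm (Fin (d + 2)))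
    {i j : Fin (d + 2)} (h : j ≠ i) :
    kuhnVertex (pivotBase v τ i) (pivotRank τ i) j = kuhnVertex v τ j := by
  ext t; simp [kuhnVertex_pivot, h]

theorem not_isDoor_pivot_corner {M : ℤ} {L : Fin (d + 2) → (Fin (d + 2) → ℤ) → Fin (d + 2)} :
    ¬ IsDoor M L (pivot (cornerBase M, cornerRank d, Fin.last (d + 1))) := by
  intro h
  have h0 := h.nonneg (Fin.last (d + 1)) (Fin.last (d + 1))
  have h1 := cycGap_corner M (Fin.last (d + 1)) (Fin.last (d + 1))
  have h2 := val_cornerRank (Fin.last (d + 1))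
  have h3 := val_cornerRank (0 : Fin (d + 2))
  have h4 := Fin.coe_sub_one (Fin.last (d + 1))
  simp only [pivot, cycGap, kuhnVertex_pivot, Fin.last_add_one] at h0
  simp only [cycGap, Fin.last_add_one] at h1
  simp only [Fin.ext_iff, Fin.val_last, Fin.val_zero] at *
  simp only [if_true, and_self] at *
  split_ifs at h3 h4 <;> omega

theorem isDoor_pivot {M : ℤ} {L : Fin (d + 2) → (Fin (d + 2) → ℤ) → Fin (d + 2)}
    (hL : IsLabelling M L) {x : (Fin (d + 2) → ℤ) × Equiv.Perm (Fin (d + 2)) × Fin (d + 2)}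
    (hx : IsDoor M L x) (hne : x ≠ (cornerBase M, cornerRank d, Fin.last (d + 1))) :
    IsDoor M L (pivot x) := by
  obtain ⟨v, τ, i⟩ := x
  refine ⟨(sum_pivotBase v τ i).trans hx.sum_eq, ?_, ?_⟩
  · by_contra! hcon
    obtain ⟨j, t, hneg⟩ := hcon
    simp only [pivot] at hneg
    have hji : j = i := by
      by_contra hji
      rw [kuhnVertex_pivot_of_ne v τ hji] at hneg
      exact absurd (hx.nonneg j t) (not_le.mpr hneg)
    rw [hji] at hneg
    obtain ⟨hti, ht1, hgap⟩ := facet_gap_eq_zero (v := v) (τ := τ) hx.nonneg hneg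
    have hlast : t = Fin.last (d + 1) := by
      by_contra htl
      obtain ⟨j, hj, rfl⟩ := hx.exists_label htl
      have := hL.pos j _ (hx.nonneg j)
      rw [hgap j hj] at this
      exact lt_irrefl _ this
    subst hlast
    rw [Fin.last_add_one] at ht1
    apply hne
    have hfirst : ∀ j, j ≠ i → ∀ t < L j (kuhnVertex v τ j), cycGap M (kuhnVertex v τ j) t = 0 :=
      fun j hj t ht => by
        have h1 := hx.nonneg j t
        by_contra h2
        exact absurd (hL.first j _ (hx.nonneg j) (hgap j hj) t (lt_of_le_of_ne h1 (Ne.symm h2)))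
          (not_le.mpr ht)
    obtain ⟨js, hjs, hjl⟩ := hx.exists_label (s := ⟨d, by omega⟩) (by simp [Fin.ext_iff])
    have hflat : ∀ k (hk : k < d + 1), kuhnVertex v τ js ⟨k, by omega⟩ = kuhnVertex v τ js 0 := by
      intro k
      induction k with
      | zero => intro _; rfl
      | succ k ih =>
        intro hk
        have h1 := hfirst js hjs ⟨k, by omega⟩ (by rw [hjl, Fin.lt_def]; simp; omega)
        have h2 : (⟨k, by omega⟩ : Fin (d + 2)) + 1 = ⟨k + 1, by omega⟩ := by
          apply Fin.ext; rw [val_add_one']; simp; omega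
        rw [cycGap, h2, if_neg (by simp [Fin.ext_iff]; omega), ih (by omega)] at h1
        linarith
    have hlastv := hgap js hjs
    rw [cycGap, Fin.last_add_one, if_pos rfl] at hlastv
    have hcorner : ∀ t, kuhnVertex v τ js t = kuhnVertex v τ js 0 + cornerBase M t := fun t => by
      by_cases ht : t = Fin.last (d + 1)
      · subst ht; simp only [cornerBase, if_true]; linarith
      · simpa [cornerBase, ht] using hflat t (Fin.val_lt_last ht)
    have hsum := sum_kuhnVertex v τ js
    rw [Finset.sum_congr rfl (fun t _ => hcorner t), Finset.sum_add_distrib, hx.sum_eq] at hsum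
    simp only [cornerBase, Finset.sum_ite_eq', Finset.mem_univ, if_true, Finset.sum_const,
      Finset.card_univ, Fintype.card_fin, nsmul_eq_mul] at hsum
    have hq : kuhnVertex v τ js 0 = 0 ∧ (js : ℕ) = 0 := by
      have hlt := js.2
      generalize kuhnVertex v τ js 0 = q at hsum
      push_cast at hsum
      have h0 : 0 ≤ q := by by_contra h; nlinarith
      have h1 : q < 1 := by by_contra h; nlinarith
      have : q = 0 := by omega
      subst this
      simp at hsum
      exact ⟨rfl, by simpa using hsum⟩
    have hjs0 : js = 0 := Fin.ext hq.2
    subst hjs0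
    have hv : v = cornerBase M := by
      ext t; have := hcorner t; rw [hq.1] at this; simpa [kuhnVertex] using this
    subst hv
    have hi0 : (i : ℕ) ≠ 0 := fun h => hjs (Fin.ext h.symm)
    have hτ0 : (τ 0 : ℕ) + 1 = i := by
      rw [ht1, Fin.coe_sub_one, if_neg (fun h => hjs h.symm)]; omega
    have hτl : (τ (Fin.last (d + 1)) : ℕ) = i := by rw [hti]
    have hanti : ∀ k (hk : k < d), (τ ⟨k + 1, by omega⟩ : ℕ) < τ ⟨k, by omega⟩ := fun k hk => by
      obtain ⟨j, hj, hjl⟩ := hx.exists_label (s := ⟨k, by omega⟩) (by simp [Fin.ext_iff]; omega)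
      have h1 := hL.pos j _ (hx.nonneg j)
      have h2 : (⟨k, by omega⟩ : Fin (d + 2)) + 1 = ⟨k + 1, by omega⟩ := by
        apply Fin.ext; rw [val_add_one']; simp; omega
      simp only [hjl, cycGap_kuhnVertex, h2] at h1
      simp only [cycGap, cornerBase, h2, Fin.ext_iff, Fin.val_last, Fin.lt_def] at h1
      omega
    have hup : ∀ k (hk : k ≤ d), (τ ⟨k, by omega⟩ : ℕ) + k ≤ τ 0 := by
      intro k
      induction k with
      | zero => intro _; exact le_refl _
      | succ k ih => intro hk; have := hanti k (by omega); have := ih (by omega); omega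
    have hdown : ∀ k (hk : k ≤ d), k ≤ (τ ⟨d - k, by omega⟩ : ℕ) := by
      intro k
      induction k with
      | zero => intro _; omega
      | succ k ih =>
        intro hk
        have h1 := hanti (d - (k + 1)) (by omega)
        have h2 := ih (by omega)
        have h3 : d - (k + 1) + 1 = d - k := by omega
        simp only [h3] at h1
        omega
    have hτd := hdown d le_rfl
    simp only [Nat.sub_self] at hτd
    have hil : (i : ℕ) = d + 1 := by
      have := i.2
      have : d ≤ (τ 0 : ℕ) := hτd
      omega
    have hτ : τ = cornerRank d := by
      ext t
      rw [val_cornerRank]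
      have htlt := t.2
      split_ifs with ht
      · have : t = Fin.last (d + 1) := Fin.ext ht
        rw [this]; omega
      · have h1 := hup t (by omega)
        have h2 := hdown (d - t) (by omega)
        have h3 : d - (d - (t : ℕ)) = t := by omega
        simp only [h3] at h2
        have h4 : (⟨(t : ℕ), by omega⟩ : Fin (d + 2)) = t := rfl
        rw [h4] at h1 h2
        omega
    have hi : i = Fin.last (d + 1) := Fin.ext hil
    rw [hτ, hi]
  · have : Function.update (fun j => L j (kuhnVertex (pivotBase v τ i) (pivotRank τ i) j)) i
        (Fin.last (d + 1)) =
        Function.update (fun j => L j (kuhnVertex v τ j)) i (Fin.last (d + 1)) := by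
      ext j
      by_cases hj : j = i
      · subst hj; simp
      · simp [hj, kuhnVertex_pivot_of_ne v τ hj]
    simp only [pivot, this]
    exact hx.inj

theorem le_of_cycGap_nonneg {M : ℤ} {x : Fin (d + 2) → ℤ} (h : ∀ t, 0 ≤ cycGap M x t)
    {s t : Fin (d + 2)} (hst : s ≤ t) : x s ≤ x t := by
  have : Monotone x := by
    rw [Fin.monotone_iff_le_succ]
    intro i
    have := h i.castSucc
    rw [cycGap, Fin.coeSucc_eq_succ, if_neg (Fin.castSucc_lt_last i).ne] at this
    linarith
  exact this hst

theorem finite_setOf_isDoor (M : ℤ) (L : Fin (d + 2) → (Fin (d + 2) → ℤ) → Fin (d + 2)) :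
    {x | IsDoor M L x}.Finite := by
  refine ((Set.finite_Icc (fun _ : Fin (d + 2) => -M) (fun _ => 2 * M)).prod
    (Set.finite_univ)).subset ?_
  rintro ⟨v, τ, i⟩ hx
  have hv : ∀ t, 0 ≤ cycGap M v t := fun t => by
    simpa [cycGap_kuhnVertex] using hx.nonneg 0 t
  have hlast := hv (Fin.last (d + 1))
  rw [cycGap, Fin.last_add_one, if_pos rfl] at hlast
  have h0 : ∀ t, v 0 ≤ v t := fun t => le_of_cycGap_nonneg hv (Fin.zero_le t)
  have h1 : ∀ t, v t ≤ v 0 + M := fun t => by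
    have := le_of_cycGap_nonneg hv (Fin.le_last t); linarith
  have hsum : ∑ t, v t = M := hx.sum_eq
  have h2 : ∑ _t : Fin (d + 2), v 0 ≤ M := hsum ▸ Finset.sum_le_sum fun t _ => h0 t
  have h3 : M ≤ ∑ _t : Fin (d + 2), (v 0 + M) := hsum.symm.le.trans (Finset.sum_le_sum fun t _ => h1 t)
  simp only [Finset.sum_const, Finset.card_univ, Fintype.card_fin, nsmul_eq_mul] at h2 h3
  push_cast at h2 h3
  have hM : 0 ≤ M := by have := h0 0; have := h1 0; linarith
  have hd : (0 : ℤ) ≤ d := Int.natCast_nonneg d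
  have h4 : v 0 ≤ M := by
    by_contra h
    nlinarith
  have h5 : -M ≤ v 0 := by
    by_contra h
    nlinarith
  refine ⟨⟨fun t => ?_, fun t => ?_⟩, trivial⟩
  · exact h5.trans (h0 t)
  · have := h1 t; simp only; linarith

theorem IsDoor.exists_other {M : ℤ} {L : Fin (d + 2) → (Fin (d + 2) → ℤ) → Fin (d + 2)}
    {v : Fin (d + 2) → ℤ} {τ : Equiv.Perm (Fin (d + 2))} {i : Fin (d + 2)}
    (h : IsDoor M L (v, τ, i)) (hfull : ¬ Function.Injective fun j => L j (kuhnVertex v τ j)) :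
    ∃ j, j ≠ i ∧ L j (kuhnVertex v τ j) = L i (kuhnVertex v τ i) := by
  refine h.exists_label fun hi => hfull ?_
  have := h.inj
  rwa [← hi, Function.update_eq_self] at this

theorem IsDoor.other {M : ℤ} {L : Fin (d + 2) → (Fin (d + 2) → ℤ) → Fin (d + 2)}
    {v : Fin (d + 2) → ℤ} {τ : Equiv.Perm (Fin (d + 2))} {i j : Fin (d + 2)}
    (h : IsDoor M L (v, τ, i))
    (hij : L j (kuhnVertex v τ j) = L i (kuhnVertex v τ i)) : IsDoor M L (v, τ, j) := by
  refine ⟨h.sum_eq, h.nonneg, ?_⟩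
  have : Function.update (fun j => L j (kuhnVertex v τ j)) j (Fin.last (d + 1)) =
      Function.update (fun j => L j (kuhnVertex v τ j)) i (Fin.last (d + 1)) ∘ Equiv.swap i j := by
    ext k
    simp only [Function.comp_apply, Function.update_apply, Equiv.swap_apply_def]
    by_cases hkj : k = j
    · subst hkj
      by_cases hki : k = i <;> simp [hki]
    · by_cases hki : k = i
      · subst hki
        simp [hkj, Ne.symm hkj, hij]
      · simp [hkj, hki]
  simp only [this]
  exact h.inj.comp (Equiv.injective _)

theorem IsDoor.eq_of_label_eq {M : ℤ} {L : Fin (d + 2) → (Fin (d + 2) → ℤ) → Fin (d + 2)}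
    {v : Fin (d + 2) → ℤ} {τ : Equiv.Perm (Fin (d + 2))} {i j k : Fin (d + 2)}
    (h : IsDoor M L (v, τ, i)) (hj : j ≠ i) (hk : k ≠ i)
    (hjk : L j (kuhnVertex v τ j) = L k (kuhnVertex v τ k)) : j = k :=
  h.inj (by simpa [hj, hk] using hjk)

/-- Rainbow Sperner lemma for the Kuhn triangulation. -/
theorem exists_rainbow_simplex {M : ℤ} (hM : 0 < M)
    {L : Fin (d + 2) → (Fin (d + 2) → ℤ) → Fin (d + 2)} (hL : IsLabelling M L) :
    ∃ v τ, (∀ j t, 0 ≤ cycGap M (kuhnVertex v τ j) t) ∧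
      Function.Injective fun j => L j (kuhnVertex v τ j) := by
  classical
  by_contra! hcon
  have hfull : ∀ x, IsDoor M L x →
      ¬ Function.Injective fun j => L j (kuhnVertex x.1 x.2.1 j) :=
    fun x hx => hcon x.1 x.2.1 hx.nonneg
  set T := (finite_setOf_isDoor M L).toFinset with hT
  have hmem : ∀ x, x ∈ T ↔ IsDoor M L x := fun x => by simp [hT]
  have hcor := isDoor_corner hM hL
  have heven : ∑ _x ∈ T, (1 : ZMod 2) = 0 := by
    have hex : ∀ x ∈ T, ∃ j, j ≠ x.2.2 ∧
        L j (kuhnVertex x.1 x.2.1 j) = L x.2.2 (kuhnVertex x.1 x.2.1 x.2.2) := fun x hx =>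
      ((hmem x).1 hx).exists_other (hfull x ((hmem x).1 hx))
    choose! g hg1 hg2 using hex
    refine Finset.sum_involution (fun x _ => (x.1, x.2.1, g x)) ?_ ?_ ?_ ?_
    · intro _ _; decide
    · intro x hx _ h
      exact hg1 x hx (congrArg (fun y => y.2.2) h)
    · intro x hx
      exact (hmem _).2 (IsDoor.other ((hmem x).1 hx) (hg2 x hx))
    · intro x hx
      have hx' : IsDoor M L (x.1, x.2.1, g x) := IsDoor.other ((hmem x).1 hx) (hg2 x hx)
      have h1 := hg1 _ ((hmem _).2 hx')
      have h2 := hg2 _ ((hmem _).2 hx')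
      have := hx'.eq_of_label_eq h1 (hg1 x hx).symm (h2.trans (hg2 x hx))
      simp only [this]
  have hodd : ∑ _x ∈ T.erase (cornerBase M, cornerRank d, Fin.last (d + 1)), (1 : ZMod 2) = 0 := by
    refine Finset.sum_involution (fun x _ => pivot x) ?_ ?_ ?_ ?_
    · intro _ _; decide
    · intro x _ _; exact pivot_ne x
    · intro x hx
      rw [Finset.mem_erase, hmem] at hx ⊢
      refine ⟨fun h => ?_, isDoor_pivot hL hx.2 hx.1⟩
      have h2 := hx.2
      rw [← pivot_pivot x, h] at h2
      exact not_isDoor_pivot_corner h2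
    · intro x _; exact pivot_pivot x
  rw [← Finset.add_sum_erase T _ ((hmem _).2 hcor), hodd] at heven
  exact absurd heven (by decide)

end Sperner

section Necklace

variable {d m : ℕ}

/-- The bead `b` lies in the `t`-th piece of the necklace of `m` beads, the cuts being at
positions `x t - x 0` on a circle of circumference `m + 1`. -/
def InArc (x : Fin (d + 2) → ℤ) (t : Fin (d + 2)) (b : Fin m) : Prop :=
  x t - x 0 ≤ (b : ℕ) ∧ ((b : ℕ) : ℤ) < x t - x 0 + cycGap (m + 1) x t

open Classical in
/-- Value to `P` of the `t`-th piece. -/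
noncomputable def arcVal (ℓ : Fin m → Fin (d + 2)) (w : Fin m → ℝ) (P : Fin (d + 2))
    (x : Fin (d + 2) → ℤ) (t : Fin (d + 2)) : ℝ :=
  ∑ b, if InArc x t b then (if ℓ b = P then w b else 0) else 0

theorem exists_eq_zero_cycGap_pos {M : ℤ} (hM : 0 < M) {x : Fin (d + 2) → ℤ}
    (hx : ∀ t, 0 ≤ cycGap M x t) : ∃ t, x t = x 0 ∧ 0 < cycGap M x t := by
  obtain ⟨t, ht, hmax⟩ := Finset.exists_max_image
    (Finset.univ.filter fun t : Fin (d + 2) => x t = x 0) id ⟨0, by simp⟩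
  simp only [Finset.mem_filter, Finset.mem_univ, true_and, id] at ht hmax
  refine ⟨t, ht, ?_⟩
  by_cases h : t = Fin.last (d + 1)
  · subst h
    rw [cycGap, Fin.last_add_one, if_pos rfl]
    linarith
  · refine lt_of_le_of_ne (hx t) fun h0 => ?_
    rw [cycGap, if_neg h] at h0
    have := hmax (t + 1) (by linarith)
    have h1 := val_add_one' t
    have h2 := Fin.val_lt_last h
    rw [if_neg (by omega)] at h1
    rw [Fin.le_def] at this
    omega

theorem exists_preferred (hm : 0 < m) (ℓ : Fin m → Fin (d + 2)) {w : Fin m → ℝ}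
    (hw : ∀ b, 0 < w b) (P : Fin (d + 2)) (x : Fin (d + 2) → ℤ)
    (hx : ∀ t, 0 ≤ cycGap (m + 1) x t) :
    ∃ t, 0 < cycGap (m + 1) x t ∧
      (cycGap (m + 1) x (Fin.last (d + 1)) = 0 → ∀ s, 0 < cycGap (m + 1) x s → t ≤ s) ∧
      (cycGap (m + 1) x (Fin.last (d + 1)) ≠ 0 →
        (∃ b : Fin m, InArc x t b) ∧ ∀ s, arcVal ℓ w P x s ≤ arcVal ℓ w P x t) := by
  classical
  obtain ⟨t₀, ht₀, hpos₀⟩ := exists_eq_zero_cycGap_pos (by positivity : (0 : ℤ) < m + 1) hx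
  by_cases hl : cycGap (m + 1) x (Fin.last (d + 1)) = 0
  · obtain ⟨t, ht, hmin⟩ := Finset.exists_min_image
      (Finset.univ.filter fun t : Fin (d + 2) => 0 < cycGap (m + 1) x t) id ⟨t₀, by simpa⟩
    simp only [Finset.mem_filter, Finset.mem_univ, true_and, id] at ht hmin
    exact ⟨t, ht, fun _ => hmin, fun h => absurd hl h⟩
  · have key : ∃ t, (∃ b : Fin m, InArc x t b) ∧ ∀ s, arcVal ℓ w P x s ≤ arcVal ℓ w P x t := by
      obtain ⟨t, ht⟩ := Finite.exists_max (arcVal ℓ w P x)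
      by_cases hb : ∃ b : Fin m, InArc x t b
      · exact ⟨t, hb, ht⟩
      · refine ⟨t₀, ⟨⟨0, hm⟩, ?_, ?_⟩, fun s => (ht s).trans ?_⟩
        · simp [ht₀]
        · simpa [ht₀] using hpos₀
        · have h0 : arcVal ℓ w P x t = 0 :=
            Finset.sum_eq_zero fun b _ => if_neg fun h => hb ⟨b, h⟩
          rw [h0]
          refine Finset.sum_nonneg fun b _ => ?_
          have := (hw b).le
          split_ifs <;> first | exact this | exact le_rfl
    obtain ⟨t, ⟨b, hb⟩, ht⟩ := key
    refine ⟨t, ?_, fun h => absurd h hl, fun _ => ⟨⟨b, hb⟩, ht⟩⟩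
    have := hb.1
    have := hb.2
    linarith

/-- Monolithic envy-free necklace division for at least two players and one bead. -/
theorem necklace_of_two_le (hm : 0 < m) (ℓ : Fin m → Fin (d + 2)) (w : Fin m → ℝ)
    (hw : ∀ b, 0 < w b) :
    ∃ c : ℕ → ℕ, (∀ i < d + 2, c i ≤ c (i + 1)) ∧ c 0 = 0 ∧ c (d + 2) = m ∧
      ∃ π : Equiv.Perm (Fin (d + 2)), ∀ P j : Fin (d + 2),
        pieceVal (fun b => if ℓ b = P then w b else 0) c j ≤
          pieceVal (fun b => if ℓ b = P then w b else 0) c (π P) := by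
  classical
  choose! L hLpos hLfirst hLpref using exists_preferred hm ℓ hw
  obtain ⟨v, τ, hdom, hinj⟩ := exists_rainbow_simplex (by positivity : (0 : ℤ) < m + 1)
    (⟨hLpos, hLfirst⟩ : IsLabelling ((m : ℤ) + 1) L)
  have hgap : ∀ j, cycGap (m + 1) (kuhnVertex v τ j) (Fin.last (d + 1)) ≠ 0 := fun j => by
    obtain ⟨j₀, hj₀⟩ := Finite.injective_iff_surjective.mp hinj (Fin.last (d + 1))
    simp only at hj₀
    have h1 := hLpos j₀ _ (hdom j₀)
    obtain ⟨⟨b, hb⟩, -⟩ := hLpref j₀ _ (hdom j₀) (by rw [hj₀] at h1; exact h1.ne')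
    rw [hj₀] at hb
    have h2 := hb.1
    have h3 := b.2
    have h4 : 2 ≤ cycGap (m + 1) (kuhnVertex v τ j₀) (Fin.last (d + 1)) := by
      rw [cycGap, Fin.last_add_one, if_pos rfl]; omega
    rw [cycGap_kuhnVertex] at h4 ⊢
    simp only [Fin.lt_def] at h4 ⊢
    omega
  set cutAt : Fin (d + 2) → Fin (d + 2) → ℤ :=
    fun j t => kuhnVertex v τ j t - kuhnVertex v τ j 0 with hcutAt
  set low : Fin (d + 2) → ℤ := fun t => v t - v 0 - if τ 0 < τ t then 1 else 0 with hlow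
  set own : ℤ → Fin (d + 2) :=
    fun z => if h : 0 ≤ z ∧ z < m then ℓ ⟨z.toNat, by omega⟩ else 0 with hown
  set cut : Fin (d + 2) → ℤ := fun t => cutAt (own (low t)) t with hcut
  have hrange : ∀ j t, low t ≤ cutAt j t ∧ cutAt j t ≤ low t + 1 := fun j t => by
    simp only [hlow, hcutAt, kuhnVertex, Fin.lt_def]; omega
  have hownb : ∀ (b : Fin m), own (b : ℕ) = ℓ b := fun b => by
    have := b.2
    simp [hown]
  have hmono : ∀ j t, t ≠ Fin.last (d + 1) → cutAt j t ≤ cutAt j (t + 1) := fun j t ht => by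
    have := hdom j t
    rw [cycGap, if_neg ht] at this
    simp only [hcutAt]; linarith
  have hnonneg : ∀ j t, 0 ≤ cutAt j t := fun j t => by
    have := le_of_cycGap_nonneg (hdom j) (Fin.zero_le t)
    simp only [hcutAt]; linarith
  have hle : ∀ j t, cutAt j t ≤ m := fun j t => by
    have h1 := le_of_cycGap_nonneg (hdom j) (Fin.le_last t)
    have h2 := lt_of_le_of_ne (hdom j (Fin.last (d + 1))) (hgap j).symm
    rw [cycGap, Fin.last_add_one, if_pos rfl] at h2
    simp only [hcutAt]; linarith
  have hcmp : ∀ (b : Fin m) t, cut t ≤ (b : ℕ) ↔ cutAt (ℓ b) t ≤ (b : ℕ) := fun b t => by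
    have h1 := hrange (own (low t)) t
    have h2 := hrange (ℓ b) t
    by_cases hb : low t = (b : ℕ)
    · simp only [hcut, hb, hownb]
    · simp only [hcut]; omega
  have hcutmono : ∀ t, t ≠ Fin.last (d + 1) → cut t ≤ cut (t + 1) := fun t ht => by
    have h1 := hrange (own (low t)) t
    have h2 := hrange (own (low (t + 1))) (t + 1)
    have h3 := hrange (own (low t)) (t + 1)
    have h4 := hmono (own (low t)) t ht
    have h5 := hrange (own (low (t + 1))) t
    have h6 := hmono (own (low (t + 1))) t ht
    by_cases h : low t = low (t + 1)
    · simp only [hcut]; rw [← h]; exact h4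
    · simp only [hcut]; omega
  have hcut0 : cut 0 = 0 := by simp [hcut, hcutAt]
  set c : ℕ → ℕ := fun i => if h : i < d + 2 then (cut ⟨i, h⟩).toNat else m with hc
  have hcfin : ∀ t : Fin (d + 2), (c t : ℤ) = cut t := fun t => by
    simp only [hc, t.2, dif_pos]
    exact Int.toNat_of_nonneg (hnonneg _ _)
  have hcend : c (d + 2) = m := by simp [hc]
  have hsucc : ∀ t : Fin (d + 2), t ≠ Fin.last (d + 1) → ((t + 1 : Fin (d + 2)) : ℕ) = t + 1 :=
    fun t ht => by
      have := Fin.val_lt_last ht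
      rw [val_add_one', if_neg (by omega)]
  have hval : ∀ P t : Fin (d + 2), pieceVal (fun b => if ℓ b = P then w b else 0) c t =
      arcVal ℓ w P (kuhnVertex v τ P) t := fun P t => by
    refine Finset.sum_congr rfl fun b _ => ?_
    by_cases hb : ℓ b = P
    · have h1 := hcmp b t
      rw [← hcfin, hb, Nat.cast_le] at h1
      refine if_congr (and_congr h1 ?_) rfl rfl
      by_cases ht : t = Fin.last (d + 1)
      · subst ht
        have h2 := b.2
        have : c ((Fin.last (d + 1) : ℕ) + 1) = m := hcend
        rw [this, cycGap, Fin.last_add_one, if_pos rfl]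
        refine iff_of_true h2 ?_
        omega
      · have h2 := hcmp b (t + 1)
        rw [← hcfin, hb, Nat.cast_le, hsucc t ht] at h2
        rw [cycGap, if_neg ht, ← not_le, h2, not_le]
        simp only [hcutAt]
        constructor <;> intro h <;> linarith
    · simp [hb]
  refine ⟨c, fun i hi => ?_, ?_, hcend,
    Equiv.ofBijective _ (Finite.injective_iff_bijective.mp hinj), fun P j => ?_⟩
  · rw [← Nat.cast_le (α := ℤ)]
    have h0 := hcfin ⟨i, hi⟩
    simp only at h0
    rw [h0]
    by_cases hl : (⟨i, hi⟩ : Fin (d + 2)) = Fin.last (d + 1)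
    · have : i = d + 1 := congrArg Fin.val hl
      subst this
      rw [hcend]
      exact hle _ _
    · have h1 := hcfin (⟨i, hi⟩ + 1)
      rw [hsucc _ hl] at h1
      simp only at h1
      rw [h1]
      exact hcutmono _ hl
  · have := hcfin 0
    rw [hcut0] at this
    exact_mod_cast this
  · rw [hval, hval]
    exact (hLpref P _ (hdom P) (hgap P)).2 j

/-- Monolithic envy-free necklace division. -/
theorem necklace_monolithic_envy_free {n : ℕ} (hn : 0 < n) (ℓ : Fin m → Fin n) (w : Fin m → ℝ)
    (hw : ∀ b, 0 < w b) :
    ∃ c : ℕ → ℕ, (∀ i < n, c i ≤ c (i + 1)) ∧ c 0 = 0 ∧ c n = m ∧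
      ∃ π : Equiv.Perm (Fin n), ∀ P j : Fin n,
        pieceVal (fun b => if ℓ b = P then w b else 0) c j ≤
          pieceVal (fun b => if ℓ b = P then w b else 0) c (π P) := by
  rcases Nat.eq_zero_or_pos m with rfl | hm
  · exact ⟨fun _ => 0, fun _ _ => le_rfl, rfl, rfl, Equiv.refl _, fun P j => by simp [pieceVal]⟩
  · match n, hn, ℓ with
    | 1, _, ℓ =>
      refine ⟨fun i => if i = 0 then 0 else m, fun i _ => ?_, rfl, rfl, Equiv.refl _,
        fun P j => ?_⟩
      · simp only; split_ifs <;> omega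
      · rw [Subsingleton.elim j P]; rfl
    | d + 2, _, ℓ => exact necklace_of_two_le hm ℓ w hw

end Necklace

section Grid

/-- The staircase which descends along the line `x = q` to height `s`, steps to the right and
descends along the line `x = q + 1`. -/
def stairPath (k q s i : ℕ) : ℤ × ℤ :=
  if i + s ≤ k then ((q : ℤ), (k : ℤ) - i) else ((q : ℤ) + 1, (k : ℤ) + 1 - i)

/-- Length of the staircase, which has no horizontal step if `s = 0`. -/
def stairLength (k s : ℕ) : ℕ := if s = 0 then k else k + 1

theorem isCut_stairPath {k l q s : ℕ} (hs : s ≤ k) (hq : q ≤ l) (hq' : s ≠ 0 → q < l) :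
    IsCut k l (stairLength k s) (stairPath k q s) := by
  have hlen : stairLength k s = k ∧ s = 0 ∨ stairLength k s = k + 1 ∧ s ≠ 0 := by
    unfold stairLength; split_ifs with h <;> simp [h]
  refine ⟨fun i hi => ?_, ?_, ?_, fun i hi => ?_, fun i hi j hj hij => ?_⟩
  · by_cases h : i + s ≤ k <;> simp only [stairPath, h, if_true, if_false] <;> omega
  · simp [stairPath, hs]
  · by_cases h : stairLength k s + s ≤ k <;>
      simp only [stairPath, h, if_true, if_false] <;> omega
  · by_cases h : i + s ≤ k <;> by_cases h' : i + 1 + s ≤ k <;>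
      simp only [stairPath, h, h', if_true, if_false] <;> push_cast
    · exact Or.inl ⟨trivial, by ring⟩
    · right; constructor <;> ring
    · omega
    · exact Or.inl ⟨trivial, by ring⟩
  · by_cases h : i + s ≤ k <;> by_cases h' : j + s ≤ k <;>
      simp only [stairPath, h, h', if_true, if_false, Prod.mk.injEq] at hij <;> omega

theorem crossCount_stairPath {k q s r : ℕ} (hr : r < k) (c : ℕ) :
    crossCount (stairLength k s) (stairPath k q s) r c =
      if (if s ≤ r then q ≤ c else q < c) then 1 else 0 := by
  have hlen : stairLength k s = k ∧ s = 0 ∨ stairLength k s = k + 1 ∧ s ≠ 0 := by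
    unfold stairLength; split_ifs with h <;> simp [h]
  have key : ∀ i, (i < stairLength k s ∧ (stairPath k q s i).1 = (stairPath k q s (i + 1)).1 ∧
      (stairPath k q s i).1 ≤ (c : ℤ) ∧
        min (stairPath k q s i).2 (stairPath k q s (i + 1)).2 = (r : ℤ)) ↔
      i = (if s ≤ r then k - 1 - r else k - r) ∧ (if s ≤ r then q ≤ c else q < c) := by
    intro i
    by_cases h : i + s ≤ k <;> by_cases h' : i + 1 + s ≤ k <;> by_cases hsr : s ≤ r <;>
      simp only [stairPath, h, h', hsr, if_true, if_false, true_and] <;> push_cast <;> omega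
  simp only [crossCount]
  split_ifs with hcond hqc hqc
  all_goals
    simp only [hcond, hqc, if_true, if_false, and_true, and_false] at key
  · rw [Finset.card_eq_one]
    exact ⟨k - 1 - r, by ext i; simpa using key i⟩
  · rw [Finset.card_eq_zero]
    ext i; simpa using key i
  · rw [Finset.card_eq_one]
    exact ⟨k - r, by ext i; simpa using key i⟩
  · rw [Finset.card_eq_zero]
    ext i; simpa using key i

/-- The cut having on its left the first `N` squares in column-by-column order, each column being
ordered from bottom to top. -/
def prefixPath (k N : ℕ) : ℕ → ℤ × ℤ := stairPath k (N / k) (N % k)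

theorem isCut_prefixPath {k l N : ℕ} (hN : N ≤ l * k) :
    IsCut k l (stairLength k (N % k)) (prefixPath k N) := by
  rcases Nat.eq_zero_or_pos k with rfl | hk
  · have : N = 0 := by omega
    subst this
    exact isCut_stairPath (by simp) (by simp) (by simp)
  · refine isCut_stairPath (Nat.mod_lt _ hk).le ?_ fun h => ?_
    · exact Nat.div_le_of_le_mul (by rwa [mul_comm])
    · rw [Nat.div_lt_iff_lt_mul hk]
      refine lt_of_le_of_ne hN fun h' => h ?_
      rw [h', Nat.mul_mod_left]

theorem crossCount_prefixPath {k r : ℕ} (hr : r < k) (N c : ℕ) :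
    crossCount (stairLength k (N % k)) (prefixPath k N) r c = if N ≤ r + k * c then 1 else 0 := by
  have hmod := Nat.mod_lt N (by omega : 0 < k)
  rw [prefixPath, crossCount_stairPath hr]
  have hdiv := Nat.div_add_mod N k
  generalize N / k = q at *
  generalize N % k = s at *
  subst hdiv
  refine if_congr ?_ rfl rfl
  rcases lt_trichotomy q c with h | rfl | h
  · have : k * (q + 1) ≤ k * c := Nat.mul_le_mul_left _ h
    rw [mul_add] at this
    split_ifs <;> constructor <;> intro <;> omega
  · split_ifs <;> constructor <;> intro <;> omega
  · have : k * (c + 1) ≤ k * q := Nat.mul_le_mul_left _ h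
    rw [mul_add] at this
    split_ifs <;> constructor <;> intro <;> omega

/-- Counting the interior cutpoints that are at most `b` locates `b` in the cutset. -/
theorem card_filter_cut_le_eq_iff {n b : ℕ} {c : ℕ → ℕ} (hc : ∀ i < n, c i ≤ c (i + 1))
    (h0 : c 0 = 0) (hb : b < c n) {j : ℕ} (hj : j < n) :
    ((Finset.range (n - 1)).filter fun t => c (t + 1) ≤ b).card = j ↔
      c j ≤ b ∧ b < c (j + 1) := by
  have hmono : ∀ i j, i ≤ j → j ≤ n → c i ≤ c j := by
    intro i j hij
    induction j, hij using Nat.le_induction with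
    | base => exact fun _ => le_rfl
    | succ j _ ih => exact fun hj => (ih (by omega)).trans (hc j (by omega))
  have hcard : ∀ j < n, c j ≤ b ∧ b < c (j + 1) →
      ((Finset.range (n - 1)).filter fun t => c (t + 1) ≤ b).card = j := by
    rintro j hj ⟨h1, h2⟩
    have : (Finset.range (n - 1)).filter (fun t => c (t + 1) ≤ b) = Finset.range j := by
      ext t
      simp only [Finset.mem_filter, Finset.mem_range]
      constructor
      · rintro ⟨h3, h4⟩
        by_contra h5
        have := hmono (j + 1) (t + 1) (by omega) (by omega)
        omega
      · intro h3
        have := hmono (t + 1) j (by omega) (by omega)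
        omega
    rw [this, Finset.card_range]
  refine ⟨fun h => ?_, hcard j hj⟩
  have hex : ∃ i, b < c (i + 1) := ⟨n - 1, by rwa [Nat.sub_add_cancel (by omega)]⟩
  classical
  have hlt : Nat.find hex < n := by
    have := Nat.find_min' hex (m := n - 1) (by rwa [Nat.sub_add_cancel (by omega)])
    omega
  have hle : c (Nat.find hex) ≤ b := by
    rcases Nat.eq_zero_or_pos (Nat.find hex) with h' | h'
    · rw [h', h0]; exact Nat.zero_le _
    · have := Nat.find_min hex (m := Nat.find hex - 1) (by omega)
      rw [Nat.sub_add_cancel h'] at this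
      omega
  have := hcard _ hlt ⟨hle, Nat.find_spec hex⟩
  rw [h] at this
  rw [this]
  exact ⟨hle, Nat.find_spec hex⟩

end Grid

/-- a `k × l` grid of indivisible squares with monolithic preferences
(square `sq` is worth `w sq > 0` to the unique player `ℓ sq`, and `0` to everyone
else) admits an envy-free allocation among `n` players using `n - 1` pairwise
non-intersecting top-to-bottom cuts (non-intersecting being expressed by the
nestedness of their left sides); and in particular (the `1 × m` case) every necklace
with monolithic preferences admits an envy-free allocation into `n` contiguous
intervals using `n - 1` integer cuts. -/
theorem grid_monolithic_envy_free
    (k l n : ℕ) (hn : 0 < n)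
    (ℓ : Fin k × Fin l → Fin n) (w : Fin k × Fin l → ℝ) (hw : ∀ sq, 0 < w sq) :
    (∃ (md : ℕ → ℕ) (pp : ℕ → ℕ → ℤ × ℤ),
      (∀ t < n - 1, IsCut k l (md t) (pp t)) ∧
      -- the cuts are ordered and pairwise non-intersecting: their left sides are nested
      (∀ t, ∀ t', t ≤ t' → t' < n - 1 → ∀ r : Fin k, ∀ c : Fin l,
        crossCount (md t) (pp t) r c % 2 = 0 →
          crossCount (md t') (pp t') r c % 2 = 0) ∧
      -- envy-free allocation of the resulting `n` pieces, where the piece index of a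
      -- square is the number of cuts it lies strictly to the right of
      (∃ π : Equiv.Perm (Fin n), ∀ P : Fin n, ∀ j : Fin n,
        (∑ sq : Fin k × Fin l,
          if ((Finset.range (n - 1)).filter (fun t =>
                crossCount (md t) (pp t) sq.1 sq.2 % 2 = 1)).card = (j : ℕ) ∧
              ℓ sq = P
          then w sq else 0) ≤
        (∑ sq : Fin k × Fin l,
          if ((Finset.range (n - 1)).filter (fun t =>
                crossCount (md t) (pp t) sq.1 sq.2 % 2 = 1)).card = (π P : ℕ) ∧
              ℓ sq = P
          then w sq else 0))) ∧
    (∀ (m' : ℕ) (ℓ' : Fin m' → Fin n) (w' : Fin m' → ℝ), (∀ b, 0 < w' b) →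
      ∃ c : ℕ → ℕ, (∀ i < n, c i ≤ c (i + 1)) ∧ c 0 = 0 ∧ c n = m' ∧
        ∃ π : Equiv.Perm (Fin n), ∀ P : Fin n, ∀ j : Fin n,
          pieceVal (fun b => if ℓ' b = P then w' b else 0) c j ≤
            pieceVal (fun b => if ℓ' b = P then w' b else 0) c (π P)) := by
  refine ⟨?_, fun m ℓ' w' hw' => necklace_monolithic_envy_free hn ℓ' w' hw'⟩
  set e : Fin k × Fin l ≃ Fin (l * k) := (Equiv.prodComm _ _).trans finProdFinEquiv with he
  have hval : ∀ sq, (e sq : ℕ) = sq.1 + k * sq.2 := fun sq => rfl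
  obtain ⟨c, hc, h0, hend, π, hπ⟩ := necklace_monolithic_envy_free hn (fun b => ℓ (e.symm b))
    (fun b => w (e.symm b)) (fun b => hw _)
  have hmono : ∀ i j, i ≤ j → j ≤ n → c i ≤ c j := by
    intro i j hij
    induction j, hij using Nat.le_induction with
    | base => exact fun _ => le_rfl
    | succ j _ ih => exact fun hj => (ih (by omega)).trans (hc j (by omega))
  have hcross : ∀ (t : ℕ) (r : Fin k) (q : Fin l),
      crossCount (stairLength k (c (t + 1) % k)) (prefixPath k (c (t + 1))) r q =
        if c (t + 1) ≤ e (r, q) then 1 else 0 := fun t r q => by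
    rw [crossCount_prefixPath r.2, hval]
  have hpiece : ∀ P j : Fin n, (∑ sq : Fin k × Fin l,
      if ((Finset.range (n - 1)).filter (fun t =>
        crossCount (stairLength k (c (t + 1) % k)) (prefixPath k (c (t + 1))) sq.1 sq.2 % 2
          = 1)).card = (j : ℕ) ∧ ℓ sq = P then w sq else 0) =
      pieceVal (fun b => if ℓ (e.symm b) = P then w (e.symm b) else 0) c j := fun P j => by
    rw [pieceVal, ← e.sum_comp]
    refine Finset.sum_congr rfl fun sq _ => ?_
    have hfilter : (Finset.range (n - 1)).filter (fun t =>
        crossCount (stairLength k (c (t + 1) % k)) (prefixPath k (c (t + 1))) sq.1 sq.2 % 2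
          = 1) = (Finset.range (n - 1)).filter (fun t => c (t + 1) ≤ e sq) := by
      refine Finset.filter_congr fun t _ => ?_
      rw [hcross]
      split_ifs with h <;> simp [h]
    rw [hfilter, ite_and, Equiv.symm_apply_apply]
    exact if_congr (card_filter_cut_le_eq_iff hc h0 (by rw [hend]; exact (e sq).2) j.2) rfl rfl
  refine ⟨fun t => stairLength k (c (t + 1) % k), fun t => prefixPath k (c (t + 1)),
    fun t ht => isCut_prefixPath ?_, fun t t' htt' ht' r q h => ?_, π, fun P j => ?_⟩
  · rw [← hend]; exact hmono _ _ (by omega) le_rfl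
  · rw [hcross] at h ⊢
    have := hmono (t + 1) (t' + 1) (by omega) (by omega)
    split_ifs at h ⊢ <;> omega
  · rw [hpiece, hpiece]; exact hπ P j
end
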